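/- Fix a real number u. As x → ∞, (1/x)·#{n : 1 < n ≤ x and ω(n + ω(n)) − log log x ≤ u·√(log log x)} tends to (1/√(2π)) ∫_{−∞}^{u} e^{−t²/2} dt. -/

import Mathlib

open Filter

noncomputable section

/-- The average of `f` over `0, …, n - 1`. -/
def rangeAvg {𝕜 : Type*} [RCLike 𝕜] (n : ℕ) (f : ℕ → 𝕜) : 𝕜 :=
  (n : 𝕜)⁻¹ * ∑ r ∈ Finset.range n, f r

theorem periodic_of_dvd {α : Type*} {d e : ℕ} {f : ℕ → α} (hf : Function.Periodic f d) (hde : d ∣ e) :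
    Function.Periodic f e := by
  obtain ⟨m, rfl⟩ := hde
  have := hf.nsmul m
  rwa [smul_eq_mul, mul_comm] at this

section RangeAvg

variable {𝕜 : Type*} [RCLike 𝕜]

theorem rangeAvg_const {n : ℕ} (hn : 0 < n) (c : 𝕜) : rangeAvg n (fun _ => c) = c := by
  have : (n : 𝕜) ≠ 0 := by exact_mod_cast hn.ne'
  simp [rangeAvg, this]

theorem rangeAvg_add (n : ℕ) (f g : ℕ → 𝕜) :
    rangeAvg n (fun r => f r + g r) = rangeAvg n f + rangeAvg n g := by
  simp [rangeAvg, Finset.sum_add_distrib, mul_add]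

theorem rangeAvg_sub (n : ℕ) (f g : ℕ → 𝕜) :
    rangeAvg n (fun r => f r - g r) = rangeAvg n f - rangeAvg n g := by
  simp [rangeAvg, Finset.sum_sub_distrib, mul_sub]

theorem rangeAvg_const_mul (n : ℕ) (c : 𝕜) (f : ℕ → 𝕜) :
    rangeAvg n (fun r => c * f r) = c * rangeAvg n f := by
  simp only [rangeAvg, ← Finset.mul_sum]; ring

theorem rangeAvg_sum {ι : Type*} (n : ℕ) (s : Finset ι) (f : ι → ℕ → 𝕜) :
    rangeAvg n (fun r => ∑ i ∈ s, f i r) = ∑ i ∈ s, rangeAvg n (f i) := by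
  simp only [rangeAvg]
  rw [Finset.sum_comm, Finset.mul_sum]

theorem rangeAvg_mono (n : ℕ) {f g : ℕ → ℝ} (h : ∀ r, f r ≤ g r) :
    rangeAvg n f ≤ rangeAvg n g := by
  simp only [rangeAvg]
  gcongr with r
  exact h r

theorem rangeAvg_nonneg (n : ℕ) {f : ℕ → ℝ} (h : ∀ r, 0 ≤ f r) : 0 ≤ rangeAvg n f :=
  mul_nonneg (by positivity) (Finset.sum_nonneg fun r _ => h r)

theorem norm_rangeAvg_le (n : ℕ) (f : ℕ → 𝕜) :
    ‖rangeAvg n f‖ ≤ rangeAvg n (fun r => ‖f r‖) := by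
  simp only [rangeAvg, norm_mul, norm_inv, RCLike.norm_natCast]
  gcongr
  exact norm_sum_le _ _

theorem norm_rangeAvg_le_of_forall (n : ℕ) {f : ℕ → 𝕜} {B : ℝ} (hB : ∀ r, ‖f r‖ ≤ B) :
    ‖rangeAvg n f‖ ≤ B := by
  rcases Nat.eq_zero_or_pos n with rfl | hn
  · simpa [rangeAvg] using (norm_nonneg _).trans (hB 0)
  · exact (norm_rangeAvg_le n f).trans
      ((rangeAvg_mono n hB).trans_eq (rangeAvg_const hn B))

theorem natCast_mul_rangeAvg (n : ℕ) (f : ℕ → 𝕜) :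
    (n : 𝕜) * rangeAvg n f = ∑ r ∈ Finset.range n, f r := by
  rcases Nat.eq_zero_or_pos n with rfl | hn
  · simp
  · have : (n : 𝕜) ≠ 0 := by exact_mod_cast hn.ne'
    rw [rangeAvg, mul_inv_cancel_left₀ this]

theorem sum_range_mul_of_periodic {d : ℕ} {f : ℕ → 𝕜} (hf : Function.Periodic f d) (m : ℕ) :
    ∑ r ∈ Finset.range (d * m), f r = m * ∑ r ∈ Finset.range d, f r := by
  induction m with
  | zero => simp
  | succ m ih =>
    rw [Nat.mul_succ, Finset.sum_range_add, ih]
    have : ∀ x, f (d * m + x) = f x := fun x => by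
      have := hf.nsmul m x
      rw [smul_eq_mul] at this
      rw [← this]; congr 1; ring
    simp only [this]
    push_cast; ring

theorem rangeAvg_mul_of_periodic {d m : ℕ} (hm : 0 < m) {f : ℕ → 𝕜}
    (hf : Function.Periodic f d) : rangeAvg (d * m) f = rangeAvg d f := by
  have : (m : 𝕜) ≠ 0 := by exact_mod_cast hm.ne'
  rw [rangeAvg, rangeAvg, sum_range_mul_of_periodic hf]
  push_cast
  rw [mul_inv, mul_assoc, inv_mul_cancel_left₀ this]

theorem norm_rangeAvg_sub_of_periodic {d R : ℕ} (hd : 0 < d) (hR : 0 < R) {f : ℕ → 𝕜}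
    (hf : Function.Periodic f d) {B : ℝ} (hB : ∀ r, ‖f r‖ ≤ B) :
    ‖rangeAvg R f - rangeAvg d f‖ ≤ 2 * d * B / R := by
  have hB0 : 0 ≤ B := (norm_nonneg _).trans (hB 0)
  have hR' : (R : 𝕜) ≠ 0 := by exact_mod_cast hR.ne'
  have hRr : (0 : ℝ) < R := by exact_mod_cast hR
  have key : (R : 𝕜) * (rangeAvg R f - rangeAvg d f) =
      ∑ r ∈ Finset.range (R % d), f r - (R % d : ℕ) * rangeAvg d f := by
    rw [mul_sub, natCast_mul_rangeAvg]
    have h1 : ∑ r ∈ Finset.range R, f r =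
        ∑ r ∈ Finset.range (d * (R / d)), f r + ∑ r ∈ Finset.range (R % d), f r := by
      conv_lhs => rw [← Nat.div_add_mod R d]
      rw [Finset.sum_range_add]
      congr 1
      refine Finset.sum_congr rfl fun x _ => ?_
      have := hf.nsmul (R / d) x
      rw [smul_eq_mul] at this
      rw [← this]; congr 1; ring
    rw [h1, sum_range_mul_of_periodic hf, ← natCast_mul_rangeAvg d]
    have h2 : (R : 𝕜) = d * (R / d : ℕ) + (R % d : ℕ) := by
      exact_mod_cast (Nat.div_add_mod R d).symm
    rw [h2]; ring
  have h3 : ‖(R : 𝕜) * (rangeAvg R f - rangeAvg d f)‖ ≤ 2 * d * B := by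
    rw [key]
    have hm : ((R % d : ℕ) : ℝ) ≤ d := by exact_mod_cast (Nat.mod_lt R hd).le
    calc _ ≤ ‖∑ r ∈ Finset.range (R % d), f r‖ + ‖((R % d : ℕ) : 𝕜) * rangeAvg d f‖ :=
          norm_sub_le _ _
      _ ≤ (R % d : ℕ) * B + (R % d : ℕ) * B := by
          gcongr
          · refine (norm_sum_le _ _).trans ((Finset.sum_le_sum fun r _ => hB r).trans_eq ?_)
            simp
          · rw [norm_mul, RCLike.norm_natCast]
            gcongr
            exact norm_rangeAvg_le_of_forall d hB
      _ ≤ d * B + d * B := by gcongr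
      _ = 2 * d * B := by ring
  rw [norm_mul, RCLike.norm_natCast] at h3
  rw [le_div_iff₀ hRr]; linarith

theorem rangeAvg_mul_of_coprime {a b : ℕ} (ha : 0 < a) (hb : 0 < b) (hab : a.Coprime b)
    {f g : ℕ → 𝕜} (hf : Function.Periodic f a) (hg : Function.Periodic g b) :
    rangeAvg (a * b) (fun r => f r * g r) = rangeAvg a f * rangeAvg b g := by
  have : ∑ r ∈ Finset.range (a * b), f r * g r =
      (∑ r ∈ Finset.range a, f r) * ∑ r ∈ Finset.range b, g r := by
    rw [Finset.sum_mul_sum, ← Finset.sum_product']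
    refine Finset.sum_bij' (fun r _ => (r % a, r % b))
      (fun x _ => (Nat.chineseRemainder hab x.1 x.2 : ℕ)) ?_ ?_ ?_ ?_ ?_
    · intro r _
      simp [Nat.mod_lt _ ha, Nat.mod_lt _ hb]
    · intro x _
      simpa using Nat.chineseRemainder_lt_mul hab x.1 x.2 ha.ne' hb.ne'
    · intro r hr
      have h := (Nat.chineseRemainder hab (r % a) (r % b)).2
      have h1 : (Nat.chineseRemainder hab (r % a) (r % b) : ℕ) ≡ r [MOD a * b] :=
        (Nat.modEq_and_modEq_iff_modEq_mul hab).1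
          ⟨h.1.trans (Nat.mod_modEq _ _), h.2.trans (Nat.mod_modEq _ _)⟩
      exact Nat.ModEq.eq_of_lt_of_lt h1
        (Nat.chineseRemainder_lt_mul hab _ _ ha.ne' hb.ne') (Finset.mem_range.1 hr)
    · rintro ⟨x, y⟩ hx
      simp only [Finset.mem_product, Finset.mem_range] at hx
      have h := (Nat.chineseRemainder hab x y).2
      ext
      · exact Eq.trans h.1 (Nat.mod_eq_of_lt hx.1)
      · exact Eq.trans h.2 (Nat.mod_eq_of_lt hx.2)
    · intro r _
      rw [hf.map_mod_nat, hg.map_mod_nat]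
  rw [rangeAvg, this, rangeAvg, rangeAvg]
  push_cast
  rw [mul_inv]; ring

theorem periodic_finset_prod {ι : Type*} {s : Finset ι} {d : ℕ} {f : ι → ℕ → 𝕜}
    (hf : ∀ i ∈ s, Function.Periodic (f i) d) : Function.Periodic (fun r => ∏ i ∈ s, f i r) d :=
  fun r => Finset.prod_congr rfl fun i hi => hf i hi r

theorem rangeAvg_prod_of_prime {P : Finset ℕ} (hP : ∀ q ∈ P, q.Prime) {f : ℕ → ℕ → 𝕜}
    (hf : ∀ q ∈ P, Function.Periodic (f q) q) :
    rangeAvg (∏ q ∈ P, q) (fun r => ∏ q ∈ P, f q r) = ∏ q ∈ P, rangeAvg q (f q) := by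
  induction P using Finset.induction_on with
  | empty => simp [rangeAvg]
  | insert p P hp ih =>
    have hP' : ∀ q ∈ P, q.Prime := fun q hq => hP q (Finset.mem_insert_of_mem hq)
    have hf' : ∀ q ∈ P, Function.Periodic (f q) q := fun q hq => hf q (Finset.mem_insert_of_mem hq)
    simp only [Finset.prod_insert hp]
    rw [← ih hP' hf']
    refine rangeAvg_mul_of_coprime (hP p (Finset.mem_insert_self _ _)).pos
      (Finset.prod_pos fun q hq => (hP' q hq).pos) ?_ (hf p (Finset.mem_insert_self _ _)) ?_
    · refine Nat.Coprime.prod_right fun q hq => ?_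
      refine (Nat.coprime_primes (hP p (Finset.mem_insert_self _ _)) (hP' q hq)).2 ?_
      rintro rfl; exact hp hq
    · exact periodic_finset_prod fun q hq => periodic_of_dvd (hf' q hq) (Finset.dvd_prod_of_mem _ hq)

end RangeAvg

theorem norm_exp_sub_taylor_le_of_nonneg {ζ : ℂ} (hre : ζ.re = 0) (hζ : ‖ζ‖ = 1) (n : ℕ) :
    ∀ x : ℝ, 0 ≤ x → ‖Complex.exp (ζ * x) -
      ∑ j ∈ Finset.range n, (ζ * x) ^ j / (j.factorial : ℂ)‖ ≤ x ^ n / n.factorial := by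
  induction n with
  | zero =>
    intro x _
    simp [Complex.norm_exp, hre]
  | succ n ih =>
    intro x hx
    have hderiv : ∀ y : ℝ, HasDerivAt (fun y : ℝ => Complex.exp (ζ * y) -
        ∑ j ∈ Finset.range (n + 1), (ζ * y) ^ j / (j.factorial : ℂ))
        (ζ * (Complex.exp (ζ * y) - ∑ j ∈ Finset.range n, (ζ * y) ^ j / (j.factorial : ℂ))) y := by
      intro y
      have h0 : HasDerivAt (fun y : ℝ => ζ * (y : ℂ)) ζ y := by
        simpa using (Complex.ofRealCLM.hasDerivAt (x := y)).const_mul ζ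
      have h1 : HasDerivAt (fun y : ℝ => ∑ j ∈ Finset.range n,
          (ζ * (y : ℂ)) ^ (j + 1) / ((j + 1).factorial : ℂ))
          (∑ j ∈ Finset.range n, ζ * ((ζ * y) ^ j / (j.factorial : ℂ))) y := by
        refine HasDerivAt.fun_sum fun j _ => ?_
        have h2 := (h0.pow (j + 1)).div_const ((j + 1).factorial : ℂ)
        convert! h2 using 1
        have : (j.factorial : ℂ) ≠ 0 := by exact_mod_cast j.factorial_ne_zero
        have h3 : (j + 1 : ℂ) ≠ 0 := by exact_mod_cast j.succ_ne_zero
        rw [Nat.factorial_succ]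
        push_cast
        field_simp
      have h4 := (h0.cexp.sub h1).sub_const 1
      convert! h4 using 1
      · funext z
        rw [Finset.sum_range_succ']
        simp; ring
      · rw [← Finset.mul_sum]; ring
    have hB : ∀ y : ℝ, HasDerivAt (fun y : ℝ => y ^ (n + 1) / ((n + 1).factorial : ℝ))
        (y ^ n / n.factorial) y := by
      intro y
      have h2 := (hasDerivAt_pow (n + 1) y).div_const ((n + 1).factorial : ℝ)
      convert! h2 using 1
      have : (n.factorial : ℝ) ≠ 0 := by exact_mod_cast n.factorial_ne_zero
      have h3 : (n + 1 : ℝ) ≠ 0 := by exact_mod_cast n.succ_ne_zero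
      rw [Nat.factorial_succ]
      push_cast
      field_simp
    refine image_norm_le_of_norm_deriv_right_le_deriv_boundary (a := 0) (b := x)
      (fun y _ => (hderiv y).continuousAt.continuousWithinAt)
      (fun y _ => (hderiv y).hasDerivWithinAt) ?_ hB ?_ ⟨hx, le_rfl⟩
    · rw [Finset.sum_range_succ']
      simp
    · intro y hy
      rw [norm_mul, hζ, one_mul]
      exact ih y hy.1

theorem norm_exp_I_mul_sub_taylor_le (n : ℕ) (x : ℝ) :
    ‖Complex.exp (Complex.I * x) - ∑ j ∈ Finset.range n, (Complex.I * x) ^ j / (j.factorial : ℂ)‖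
      ≤ |x| ^ n / n.factorial := by
  rcases le_total 0 x with hx | hx
  · rw [abs_of_nonneg hx]
    exact norm_exp_sub_taylor_le_of_nonneg (by simp) (by simp) n x hx
  · have := norm_exp_sub_taylor_le_of_nonneg (ζ := -Complex.I) (by simp) (by simp) n (-x)
      (by linarith)
    rw [abs_of_nonpos hx]
    simpa using this

theorem norm_rangeAvg_sum_pow_sub_le {P : Finset ℕ} (hP : ∀ q ∈ P, q.Prime) {Y : ℕ}
    (hY : ∀ q ∈ P, q ≤ Y) {g : ℕ → ℕ → ℝ} (hg : ∀ q ∈ P, Function.Periodic (g q) q)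
    (hb : ∀ q ∈ P, ∀ r, |g q r| ≤ 2) {R : ℕ} (hR : 0 < R) (j : ℕ) :
    |rangeAvg R (fun r => (∑ q ∈ P, g q r) ^ j) -
      rangeAvg (∏ q ∈ P, q) (fun r => (∑ q ∈ P, g q r) ^ j)| ≤ 2 * (2 * (Y : ℝ) ^ 2) ^ j / R := by
  have hR' : (0 : ℝ) < R := by exact_mod_cast hR
  have hexp : (fun r => (∑ q ∈ P, g q r) ^ j) = fun r =>
      ∑ s ∈ Fintype.piFinset (fun _ : Fin j => P), ∏ i, g (s i) r := by
    funext r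
    rw [← Finset.prod_univ_sum (fun _ : Fin j => P) (fun _ q => g q r)]
    simp
  rw [hexp, rangeAvg_sum, rangeAvg_sum, ← Finset.sum_sub_distrib]
  have hcard : P.card ≤ Y := by
    have : P ⊆ Finset.Icc 1 Y := fun q hq => Finset.mem_Icc.2 ⟨(hP q hq).one_lt.le, hY q hq⟩
    simpa using Finset.card_le_card this
  have hterm : ∀ s ∈ Fintype.piFinset (fun _ : Fin j => P),
      |rangeAvg R (fun r => ∏ i, g (s i) r) -
        rangeAvg (∏ q ∈ P, q) (fun r => ∏ i, g (s i) r)| ≤ 2 * (Y : ℝ) ^ j * 2 ^ j / R := by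
    intro s hs
    rw [Fintype.mem_piFinset] at hs
    set D : Finset ℕ := Finset.univ.image s with hD
    have hDP : D ⊆ P := by
      intro q hq
      obtain ⟨i, _, rfl⟩ := Finset.mem_image.1 hq
      exact hs i
    have hper : Function.Periodic (fun r => ∏ i, g (s i) r) (∏ q ∈ D, q) :=
      periodic_finset_prod fun i _ => periodic_of_dvd (hg _ (hs i))
        (Finset.dvd_prod_of_mem (fun q => q) (Finset.mem_image_of_mem s (Finset.mem_univ i)))
    have hDpos : 0 < ∏ q ∈ D, q := Finset.prod_pos fun q hq => (hP q (hDP hq)).pos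
    have hsplit : ∏ q ∈ P, q = (∏ q ∈ D, q) * ∏ q ∈ P \ D, q := by
      rw [mul_comm, Finset.prod_sdiff hDP]
    have hpos2 : 0 < ∏ q ∈ P \ D, q :=
      Finset.prod_pos fun q hq => (hP q (Finset.sdiff_subset hq)).pos
    rw [hsplit, rangeAvg_mul_of_periodic hpos2 hper]
    have hbd : ∀ r, ‖∏ i, g (s i) r‖ ≤ 2 ^ j := by
      intro r
      rw [norm_prod]
      refine (Finset.prod_le_prod (fun _ _ => norm_nonneg _) fun i _ => hb _ (hs i) r).trans_eq ?_
      simp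
    refine (norm_rangeAvg_sub_of_periodic hDpos hR hper hbd).trans ?_
    have hDY : ((∏ q ∈ D, q : ℕ) : ℝ) ≤ (Y : ℝ) ^ j := by
      rcases Nat.eq_zero_or_pos j with rfl | hj
      · simp [hD]
      have hY1 : 1 ≤ Y := (hP _ (hs ⟨0, hj⟩)).one_lt.le.trans (hY _ (hs ⟨0, hj⟩))
      have h1 : ∏ q ∈ D, q ≤ Y ^ D.card :=
        Finset.prod_le_pow_card _ _ _ fun q hq => hY q (hDP hq)
      have h2 : D.card ≤ j := Finset.card_image_le.trans_eq (by simp)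
      exact_mod_cast h1.trans (Nat.pow_le_pow_right hY1 h2)
    gcongr
  refine (Finset.abs_sum_le_sum_abs _ _).trans ((Finset.sum_le_sum hterm).trans ?_)
  rw [Finset.sum_const, nsmul_eq_mul, Fintype.card_piFinset]
  simp only [Finset.prod_const, Finset.card_univ, Fintype.card_fin]
  have : ((P.card ^ j : ℕ) : ℝ) ≤ (Y : ℝ) ^ j := by exact_mod_cast Nat.pow_le_pow_left hcard j
  calc _ ≤ (Y : ℝ) ^ j * (2 * (Y : ℝ) ^ j * 2 ^ j / R) := by gcongr
    _ = _ := by rw [mul_pow, ← pow_mul]; ring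

theorem norm_rangeAvg_exp_sub_le {P : Finset ℕ} (hP : ∀ q ∈ P, q.Prime) {Y : ℕ} (hY1 : 1 ≤ Y)
    (hY : ∀ q ∈ P, q ≤ Y) {g : ℕ → ℕ → ℝ} (hg : ∀ q ∈ P, Function.Periodic (g q) q)
    (hb : ∀ q ∈ P, ∀ r, |g q r| ≤ 2) {R : ℕ} (hR : 0 < R) (J : ℕ) {τ M : ℝ} (hτ : |τ| ≤ 1)
    (hM₁ : rangeAvg (∏ q ∈ P, q) (fun r => Real.exp (2 * τ * ∑ q ∈ P, g q r)) ≤ M)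
    (hM₂ : rangeAvg (∏ q ∈ P, q) (fun r => Real.exp (-(2 * τ) * ∑ q ∈ P, g q r)) ≤ M) :
    ‖rangeAvg R (fun r => Complex.exp (Complex.I * (τ * ∑ q ∈ P, g q r : ℝ))) -
      rangeAvg (∏ q ∈ P, q) (fun r => Complex.exp (Complex.I * (τ * ∑ q ∈ P, g q r : ℝ)))‖ ≤
      6 * (2 * (Y : ℝ) ^ 2) ^ (2 * J) / R + 4 * M / 4 ^ J := by
  have hR' : (0 : ℝ) < R := by exact_mod_cast hR
  set N := ∏ q ∈ P, q with hN
  set G : ℕ → ℝ := fun r => ∑ q ∈ P, g q r with hG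
  set E : ℕ → ℂ := fun r => Complex.exp (Complex.I * (τ * G r : ℝ)) with hE
  set T : ℕ → ℂ := fun r => ∑ j ∈ Finset.range (2 * J),
    (Complex.I * (τ * G r : ℝ)) ^ j / (j.factorial : ℂ) with hT
  have htay : ∀ n, ‖rangeAvg n E - rangeAvg n T‖ ≤
      |τ| ^ (2 * J) / (2 * J).factorial * rangeAvg n (fun r => G r ^ (2 * J)) := by
    intro n
    rw [← rangeAvg_sub, ← rangeAvg_const_mul]
    refine (norm_rangeAvg_le _ _).trans (rangeAvg_mono _ fun r => ?_)
    refine (norm_exp_I_mul_sub_taylor_le (2 * J) (τ * G r)).trans_eq ?_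
    rw [abs_mul, mul_pow, (even_two_mul J).pow_abs (a := G r)]
    ring
  have hTn : ∀ n, rangeAvg n T = ∑ j ∈ Finset.range (2 * J),
      (Complex.I * τ) ^ j / (j.factorial : ℂ) * ((rangeAvg n (fun r => G r ^ j) : ℝ) : ℂ) := by
    intro n
    rw [hT, rangeAvg_sum]
    refine Finset.sum_congr rfl fun j _ => ?_
    simp only [rangeAvg]
    push_cast
    rw [Finset.mul_sum, Finset.mul_sum, Finset.mul_sum]
    refine Finset.sum_congr rfl fun r _ => ?_
    rw [← mul_assoc, mul_pow]
    ring
  have hmom : ∀ j, |rangeAvg R (fun r => G r ^ j) - rangeAvg N (fun r => G r ^ j)| ≤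
      2 * (2 * (Y : ℝ) ^ 2) ^ j / R := fun j => norm_rangeAvg_sum_pow_sub_le hP hY hg hb hR j
  have hbase : (1 : ℝ) ≤ 2 * (Y : ℝ) ^ 2 := by
    have : (1 : ℝ) ≤ Y := by exact_mod_cast hY1
    nlinarith
  have hmom' : ∀ j ≤ 2 * J, |τ| ^ j / j.factorial *
      |rangeAvg R (fun r => G r ^ j) - rangeAvg N (fun r => G r ^ j)| ≤
      (1 : ℝ) ^ j / j.factorial * (2 * (2 * (Y : ℝ) ^ 2) ^ (2 * J) / R) := by
    intro j hj
    gcongr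
    refine (hmom j).trans ?_
    gcongr
  have hTdiff : ‖rangeAvg R T - rangeAvg N T‖ ≤ ∑ j ∈ Finset.range (2 * J),
      (1 : ℝ) ^ j / j.factorial * (2 * (2 * (Y : ℝ) ^ 2) ^ (2 * J) / R) := by
    rw [hTn, hTn, ← Finset.sum_sub_distrib]
    refine (norm_sum_le _ _).trans (Finset.sum_le_sum fun j hj => ?_)
    rw [← mul_sub, norm_mul, ← Complex.ofReal_sub, Complex.norm_real]
    have : ‖(Complex.I * (τ : ℂ)) ^ j / (j.factorial : ℂ)‖ = |τ| ^ j / j.factorial := by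
      simp
    rw [this]
    exact hmom' j (Finset.mem_range.1 hj).le
  have hmodel : |τ| ^ (2 * J) / (2 * J).factorial * rangeAvg N (fun r => G r ^ (2 * J)) ≤
      2 * M / 4 ^ J := by
    have h1 : ∀ r, |τ| ^ (2 * J) / (2 * J).factorial * G r ^ (2 * J) ≤
        1 / 4 ^ J * (Real.exp (2 * τ * G r) + Real.exp (-(2 * τ) * G r)) := by
      intro r
      have h2 : |2 * τ * G r| ^ (2 * J) / (2 * J).factorial ≤ Real.exp |2 * τ * G r| :=
        Real.pow_div_factorial_le_exp _ (abs_nonneg _) _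
      have h3 : Real.exp |2 * τ * G r| ≤ Real.exp (2 * τ * G r) + Real.exp (-(2 * τ) * G r) := by
        rcases abs_cases (2 * τ * G r) with h | h <;> rw [h.1]
        · linarith [Real.exp_pos (-(2 * τ) * G r)]
        · rw [neg_mul]
          linarith [Real.exp_pos (2 * τ * G r)]
      have h4 : |2 * τ * G r| ^ (2 * J) = 4 ^ J * (|τ| ^ (2 * J) * G r ^ (2 * J)) := by
        rw [abs_mul, abs_mul, mul_pow, mul_pow, (even_two_mul J).pow_abs (a := G r), abs_two,
          pow_mul 2]
        norm_num; ring
      rw [h4] at h2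
      have h5 : (0 : ℝ) < 4 ^ J := by positivity
      have h6 := h2.trans h3
      rw [one_div, inv_mul_eq_div, le_div_iff₀ h5]
      refine le_trans (le_of_eq ?_) h6
      ring
    rw [← rangeAvg_const_mul]
    refine (rangeAvg_mono _ h1).trans ?_
    rw [rangeAvg_const_mul, rangeAvg_add]
    have h5 : (0 : ℝ) < 4 ^ J := by positivity
    rw [one_div, inv_mul_eq_div]
    gcongr
    linarith
  have htrue : |τ| ^ (2 * J) / (2 * J).factorial * rangeAvg R (fun r => G r ^ (2 * J)) ≤
      2 * M / 4 ^ J + (1 : ℝ) ^ (2 * J) / (2 * J).factorial *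
        (2 * (2 * (Y : ℝ) ^ 2) ^ (2 * J) / R) := by
    have h1 := hmom' (2 * J) le_rfl
    have h2 : |τ| ^ (2 * J) / (2 * J).factorial * rangeAvg R (fun r => G r ^ (2 * J)) ≤
        |τ| ^ (2 * J) / (2 * J).factorial * rangeAvg N (fun r => G r ^ (2 * J)) +
        |τ| ^ (2 * J) / (2 * J).factorial *
          |rangeAvg R (fun r => G r ^ (2 * J)) - rangeAvg N (fun r => G r ^ (2 * J))| := by
      rw [← mul_add]
      gcongr
      linarith [le_abs_self (rangeAvg R (fun r => G r ^ (2 * J)) -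
        rangeAvg N (fun r => G r ^ (2 * J)))]
    linarith
  have hsum : ∑ j ∈ Finset.range (2 * J + 1), (1 : ℝ) ^ j / j.factorial ≤ 3 :=
    (Real.sum_le_exp_of_nonneg zero_le_one _).trans Real.exp_one_lt_three.le
  have htri : ‖rangeAvg R E - rangeAvg N E‖ ≤ ‖rangeAvg R E - rangeAvg R T‖ +
      ‖rangeAvg R T - rangeAvg N T‖ + ‖rangeAvg N E - rangeAvg N T‖ := by
    calc ‖rangeAvg R E - rangeAvg N E‖ = ‖(rangeAvg R E - rangeAvg R T) +
          (rangeAvg R T - rangeAvg N T) - (rangeAvg N E - rangeAvg N T)‖ := by congr 1; ring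
      _ ≤ _ := (norm_sub_le _ _).trans (by gcongr; exact norm_add_le _ _)
  rw [← Finset.sum_mul] at hTdiff
  rw [Finset.sum_range_succ] at hsum
  have hpos : 0 ≤ 2 * (2 * (Y : ℝ) ^ 2) ^ (2 * J) / R := by positivity
  have h7 := mul_le_mul_of_nonneg_right hsum hpos
  rw [add_mul] at h7
  have h8 : 6 * (2 * (Y : ℝ) ^ 2) ^ (2 * J) / R = 3 * (2 * (2 * (Y : ℝ) ^ 2) ^ (2 * J) / R) := by
    ring
  have h9 : 4 * M / 4 ^ J = 2 * M / 4 ^ J + 2 * M / 4 ^ J := by ring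
  rw [h8, h9]
  linarith [htay R, htay N]

theorem rangeAvg_exp_sum_le {P : Finset ℕ} (hP : ∀ q ∈ P, q.Prime)
    {g : ℕ → ℕ → ℝ} (hg : ∀ q ∈ P, Function.Periodic (g q) q)
    (hb : ∀ q ∈ P, ∀ r, |g q r| ≤ 2) {s : ℝ} (hs : |s| ≤ 1 / 2) {m v : ℕ → ℝ}
    (hm : ∀ q ∈ P, |rangeAvg q (g q)| ≤ m q)
    (hv : ∀ q ∈ P, rangeAvg q (fun r => g q r ^ 2) ≤ v q) :
    rangeAvg (∏ q ∈ P, q) (fun r => Real.exp (s * ∑ q ∈ P, g q r)) ≤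
      Real.exp (|s| * ∑ q ∈ P, m q + s ^ 2 * ∑ q ∈ P, v q) := by
  have h1 : (fun r => Real.exp (s * ∑ q ∈ P, g q r)) = fun r => ∏ q ∈ P, Real.exp (s * g q r) := by
    funext r
    rw [Finset.mul_sum, Real.exp_sum]
  rw [h1, rangeAvg_prod_of_prime hP (f := fun q r => Real.exp (s * g q r)), Finset.mul_sum,
    Finset.mul_sum, ← Finset.sum_add_distrib, Real.exp_sum]
  · refine Finset.prod_le_prod (fun q _ => rangeAvg_nonneg _ fun r => (Real.exp_pos _).le) ?_
    intro q hq
    have h2 : ∀ r, Real.exp (s * g q r) ≤ 1 + s * g q r + s ^ 2 * g q r ^ 2 := by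
      intro r
      have h3 : |s * g q r| ≤ 1 := by
        rw [abs_mul]
        nlinarith [hb q hq r, abs_nonneg s, abs_nonneg (g q r)]
      have h4 := (abs_le.1 (Real.abs_exp_sub_one_sub_id_le h3)).2
      rw [mul_pow] at h4
      linarith
    refine (rangeAvg_mono _ h2).trans ?_
    rw [rangeAvg_add, rangeAvg_add, rangeAvg_const (hP q hq).pos, rangeAvg_const_mul,
      rangeAvg_const_mul]
    refine le_trans ?_ (Real.add_one_le_exp _)
    have h5 : s * rangeAvg q (g q) ≤ |s| * m q := by
      refine (le_abs_self _).trans ?_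
      rw [abs_mul]
      exact mul_le_mul_of_nonneg_left (hm q hq) (abs_nonneg _)
    have h6 := mul_le_mul_of_nonneg_left (hv q hq) (sq_nonneg s)
    linarith
  · intro q hq r
    change Real.exp _ = Real.exp _
    rw [hg q hq r]

/-- The mean of `exp (iθ (ξ - 1/q))` for a Bernoulli variable `ξ` with mean `1/q`. -/
def bernoulliFactor (q : ℕ) (θ : ℝ) : ℂ :=
  Complex.exp (Complex.I * ((-θ / q : ℝ) : ℂ)) *
    (1 + (Complex.exp (Complex.I * (θ : ℂ)) - 1) / q)

theorem norm_exp_I_mul_ofReal (x : ℝ) : ‖Complex.exp (Complex.I * (x : ℂ))‖ = 1 := by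
  rw [mul_comm]; exact Complex.norm_exp_ofReal_mul_I x

theorem norm_bernoulliFactor_le {q : ℕ} (hq : 0 < q) (θ : ℝ) : ‖bernoulliFactor q θ‖ ≤ 1 := by
  have hq1 : (1 : ℝ) ≤ q := by exact_mod_cast hq
  have hq0 : (q : ℂ) ≠ 0 := by exact_mod_cast hq.ne'
  rw [bernoulliFactor, norm_mul, norm_exp_I_mul_ofReal, one_mul]
  have : (1 + (Complex.exp (Complex.I * (θ : ℂ)) - 1) / q : ℂ) =
      ((1 - 1 / q : ℝ) : ℂ) + Complex.exp (Complex.I * (θ : ℂ)) * ((1 / q : ℝ) : ℂ) := by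
    push_cast; field_simp; ring
  rw [this]
  refine (norm_add_le _ _).trans ?_
  rw [norm_mul, norm_exp_I_mul_ofReal, Complex.norm_real, Complex.norm_real, one_mul,
    Real.norm_of_nonneg (by rw [sub_nonneg, div_le_one (by linarith)]; exact hq1),
    Real.norm_of_nonneg (by positivity)]
  linarith

theorem conj_bernoulliFactor (q : ℕ) (θ : ℝ) :
    (starRingEnd ℂ) (bernoulliFactor q θ) = bernoulliFactor q (-θ) := by
  simp only [bernoulliFactor, map_mul, map_add, map_one, map_div₀, map_sub, ← Complex.exp_conj,
    Complex.conj_I, Complex.conj_ofReal, map_natCast]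
  have h1 : -Complex.I * ((-θ / q : ℝ) : ℂ) = Complex.I * ((- -θ / q : ℝ) : ℂ) := by
    push_cast; ring
  have h2 : -Complex.I * (θ : ℂ) = Complex.I * ((-θ : ℝ) : ℂ) := by
    push_cast; ring
  rw [h1, h2]

theorem norm_exp_I_mul_sub_one_le (x : ℝ) :
    ‖Complex.exp (Complex.I * (x : ℂ)) - 1‖ ≤ |x| := by
  simpa using Real.norm_exp_I_mul_ofReal_sub_one_le (x := x)

theorem norm_prod_sub_prod_le {ι : Type*} (s : Finset ι) (f g : ι → ℂ)
    (hf : ∀ i ∈ s, ‖f i‖ ≤ 1) (hg : ∀ i ∈ s, ‖g i‖ ≤ 1) :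
    ‖∏ i ∈ s, f i - ∏ i ∈ s, g i‖ ≤ ∑ i ∈ s, ‖f i - g i‖ := by
  classical
  induction s using Finset.induction_on with
  | empty => simp
  | insert a s ha ih =>
    rw [Finset.prod_insert ha, Finset.prod_insert ha, Finset.sum_insert ha]
    have ih' := ih (fun i hi => hf i (Finset.mem_insert_of_mem hi))
      (fun i hi => hg i (Finset.mem_insert_of_mem hi))
    have h1 : ‖∏ i ∈ s, f i‖ ≤ 1 := by
      rw [norm_prod]
      exact Finset.prod_le_one (fun i _ => norm_nonneg _)
        (fun i hi => hf i (Finset.mem_insert_of_mem hi))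
    have : f a * ∏ i ∈ s, f i - g a * ∏ i ∈ s, g i =
        (f a - g a) * ∏ i ∈ s, f i + g a * (∏ i ∈ s, f i - ∏ i ∈ s, g i) := by ring
    rw [this]
    refine (norm_add_le _ _).trans (add_le_add ?_ ?_)
    · rw [norm_mul]; exact mul_le_of_le_one_right (norm_nonneg _) h1
    · rw [norm_mul]
      exact (mul_le_of_le_one_left (norm_nonneg _) (hg a (Finset.mem_insert_self _ _))).trans ih'

theorem norm_rangeAvg_exp_sub_bernoulliFactor_le {q : ℕ} (hq : 0 < q) {e e' : ℕ → ℝ}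
    (he : ∀ r, e r = 0 ∨ e r = 1) (he' : ∀ r, e' r = 0 ∨ e' r = 1) {α β : ℝ}
    (hα : |α| ≤ 1) (hβ : |β| ≤ 1) (τ : ℝ) :
    ‖rangeAvg q (fun r => Complex.exp (Complex.I *
        ((τ * (α * (e r - 1 / q) + β * (e' r - 1 / q)) : ℝ) : ℂ))) -
      bernoulliFactor q (α * τ) * bernoulliFactor q (β * τ)‖ ≤
    |τ| * (|rangeAvg q e - 1 / q| + |rangeAvg q e' - 1 / q|) +
      τ ^ 2 * |rangeAvg q (fun r => e r * e' r) - 1 / q ^ 2| := by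
  set w := Complex.exp (Complex.I * ((α * τ : ℝ) : ℂ)) - 1 with hw
  set w' := Complex.exp (Complex.I * ((β * τ : ℝ) : ℂ)) - 1 with hw'
  set E := Complex.exp (Complex.I * ((-(α * τ) / q : ℝ) : ℂ)) *
    Complex.exp (Complex.I * ((-(β * τ) / q : ℝ) : ℂ)) with hE
  have hEn : ‖E‖ = 1 := by
    rw [hE, norm_mul, norm_exp_I_mul_ofReal, norm_exp_I_mul_ofReal, one_mul]
  have hwn : ‖w‖ ≤ |τ| := by
    refine (norm_exp_I_mul_sub_one_le _).trans ?_
    rw [abs_mul]; exact mul_le_of_le_one_left (abs_nonneg _) hα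
  have hwn' : ‖w'‖ ≤ |τ| := by
    refine (norm_exp_I_mul_sub_one_le _).trans ?_
    rw [abs_mul]; exact mul_le_of_le_one_left (abs_nonneg _) hβ
  have hpt : ∀ r, Complex.exp (Complex.I *
        ((τ * (α * (e r - 1 / q) + β * (e' r - 1 / q)) : ℝ) : ℂ)) =
      E * (1 + (w * (e r : ℂ) + w' * (e' r : ℂ)) + w * w' * ((e r * e' r : ℝ) : ℂ)) := by
    intro r
    have h0 : Complex.exp (Complex.I *
        ((τ * (α * (e r - 1 / q) + β * (e' r - 1 / q)) : ℝ) : ℂ)) = E *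
        (Complex.exp (Complex.I * ((α * τ * e r : ℝ) : ℂ)) *
          Complex.exp (Complex.I * ((β * τ * e' r : ℝ) : ℂ))) := by
      rw [hE, ← Complex.exp_add, ← Complex.exp_add, ← Complex.exp_add]
      congr 1; push_cast; ring
    rw [h0]
    congr 1
    rcases he r with h | h <;> rcases he' r with h' | h' <;> simp [h, h', hw, hw']
    ring
  have hcast : ∀ f : ℕ → ℝ, rangeAvg q (fun r => (f r : ℂ)) = ((rangeAvg q f : ℝ) : ℂ) := by
    intro f; simp [rangeAvg]
  have havg : rangeAvg q (fun r => Complex.exp (Complex.I *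
        ((τ * (α * (e r - 1 / q) + β * (e' r - 1 / q)) : ℝ) : ℂ))) =
      E * (1 + (w * (rangeAvg q e : ℝ) + w' * (rangeAvg q e' : ℝ)) +
        w * w' * (rangeAvg q (fun r => e r * e' r) : ℝ)) := by
    simp only [hpt]
    rw [rangeAvg_const_mul, rangeAvg_add, rangeAvg_add, rangeAvg_add, rangeAvg_const hq,
      rangeAvg_const_mul, rangeAvg_const_mul, rangeAvg_const_mul, hcast, hcast, hcast]
  have hC : bernoulliFactor q (α * τ) * bernoulliFactor q (β * τ) =
      E * ((1 + w / q) * (1 + w' / q)) := by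
    simp only [bernoulliFactor, hE, hw, hw']; ring
  rw [havg, hC, ← mul_sub, norm_mul, hEn, one_mul]
  have : (1 + (w * (rangeAvg q e : ℝ) + w' * (rangeAvg q e' : ℝ)) +
        w * w' * (rangeAvg q (fun r => e r * e' r) : ℝ)) - ((1 + w / q) * (1 + w' / q)) =
      w * ((rangeAvg q e - 1 / q : ℝ) : ℂ) + w' * ((rangeAvg q e' - 1 / q : ℝ) : ℂ) +
        w * w' * ((rangeAvg q (fun r => e r * e' r) - 1 / q ^ 2 : ℝ) : ℂ) := by
    push_cast; ring
  rw [this]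
  refine (norm_add₃_le).trans ?_
  rw [norm_mul, norm_mul, norm_mul, norm_mul, Complex.norm_real, Complex.norm_real,
    Complex.norm_real, Real.norm_eq_abs, Real.norm_eq_abs, Real.norm_eq_abs, mul_add, ← sq_abs τ,
    sq |τ|]
  gcongr

/-- The indicator of `q ∣ p (r + 1) + k`. -/
def dvdInd (p k q r : ℕ) : ℝ := if q ∣ p * (r + 1) + k then 1 else 0

theorem dvdInd_eq (p k q r : ℕ) : dvdInd p k q r = 0 ∨ dvdInd p k q r = 1 := by
  unfold dvdInd; split_ifs <;> simp

theorem periodic_dvdInd (p k q : ℕ) : Function.Periodic (dvdInd p k q) q := by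
  intro r
  have : p * (r + q + 1) + k = (p * (r + 1) + k) + q * p := by ring
  simp only [dvdInd, this, Nat.dvd_add_left (Dvd.intro p rfl)]

theorem rangeAvg_dvdInd {p k q : ℕ} (hp : p.Prime) (hq : q.Prime) (hk : 0 < k) (hkp : k < p) :
    rangeAvg q (dvdInd p k q) = 1 / q - if q = p then 1 / (q : ℝ) else 0 := by
  have := Fact.mk hq
  split_ifs with h
  · subst h
    have : dvdInd q k q = fun _ => 0 := by
      funext r
      rw [dvdInd, if_neg]
      rw [Nat.dvd_add_right (Dvd.intro _ rfl)]
      exact Nat.not_dvd_of_pos_of_lt hk hkp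
    rw [this, rangeAvg_const hq.pos]; simp
  · have hpq : (p : ZMod q) ≠ 0 := by
      rw [Ne, ZMod.natCast_eq_zero_iff]
      exact fun hd => h ((Nat.prime_dvd_prime_iff_eq hq hp).1 hd)
    set c : ZMod q := -(k : ZMod q) / p - 1 with hc
    have hiff : ∀ r ∈ Finset.range q, (q ∣ p * (r + 1) + k) ↔ r = c.val := by
      intro r hr
      rw [← ZMod.natCast_eq_zero_iff]
      have h1 : ((p * (r + 1) + k : ℕ) : ZMod q) = 0 ↔ (r : ZMod q) = c := by
        push_cast
        rw [hc]
        constructor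
        · intro h2
          have : (p : ZMod q) * (r + 1) = -k := by linear_combination h2
          rw [← this, mul_div_cancel_left₀ _ hpq]; ring
        · intro h2
          rw [h2]
          have := mul_div_cancel₀ (-(k : ZMod q)) hpq
          field_simp
          ring
      rw [h1]
      constructor
      · intro h2; rw [← h2, ZMod.val_cast_of_lt (Finset.mem_range.1 hr)]
      · intro h2; rw [h2, ZMod.natCast_zmod_val]
    rw [rangeAvg]
    have : ∑ r ∈ Finset.range q, dvdInd p k q r =
        ∑ r ∈ Finset.range q, if r = c.val then (1 : ℝ) else 0 := by
      refine Finset.sum_congr rfl fun r hr => ?_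
      simp only [dvdInd, hiff r hr]
    rw [this, Finset.sum_ite_eq', if_pos (Finset.mem_range.2 (ZMod.val_lt c))]
    simp

theorem abs_rangeAvg_dvdInd_mul_sub_le {p p' k q : ℕ} (hp : p.Prime) (hq : q.Prime)
    (hk : 0 < k) (hkp : k < p) :
    |rangeAvg q (fun r => dvdInd p k q r * dvdInd p' k q r) - 1 / q ^ 2| ≤
      1 / q ^ 2 + if q ∣ k * ((p : ℤ) - p').natAbs then 1 / (q : ℝ) else 0 := by
  have hqpos : (0 : ℝ) < q := by exact_mod_cast hq.pos
  split_ifs with h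
  · have h1 : rangeAvg q (fun r => dvdInd p k q r * dvdInd p' k q r) ≤ 1 / q := by
      refine (rangeAvg_mono q (g := dvdInd p k q) fun r => ?_).trans ?_
      · rcases dvdInd_eq p k q r with h1 | h1 <;> rcases dvdInd_eq p' k q r with h2 | h2 <;>
          simp [h1, h2]
      · rw [rangeAvg_dvdInd hp hq hk hkp]
        split_ifs
        · simp
        · simp
    have h0 : 0 ≤ rangeAvg q (fun r => dvdInd p k q r * dvdInd p' k q r) := by
      refine rangeAvg_nonneg _ fun r => ?_
      rcases dvdInd_eq p k q r with h1 | h1 <;> rcases dvdInd_eq p' k q r with h2 | h2 <;>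
          simp [h1, h2]
    have : (0 : ℝ) ≤ 1 / q ^ 2 := by positivity
    rw [abs_le]; constructor <;> linarith
  · have : (fun r => dvdInd p k q r * dvdInd p' k q r) = fun _ => 0 := by
      funext r
      by_contra hne
      apply h
      have h1 : q ∣ p * (r + 1) + k := by
        by_contra h1; exact hne (by simp [dvdInd, h1])
      have h2 : q ∣ p' * (r + 1) + k := by
        by_contra h1; exact hne (by simp [dvdInd, h1])
      have h1' : (q : ℤ) ∣ p * (r + 1) + k := by exact_mod_cast h1
      have h2' : (q : ℤ) ∣ p' * (r + 1) + k := by exact_mod_cast h2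
      have h3 : (q : ℤ) ∣ k * (p - p') := by
        have := (h2'.mul_left (p : ℤ)).sub (h1'.mul_left (p' : ℤ))
        have he : (k : ℤ) * (p - p') = p * (p' * (r + 1) + k) - p' * (p * (r + 1) + k) := by ring
        rwa [he]
      have := Int.natAbs_dvd_natAbs.2 h3
      simpa [Int.natAbs_mul] using this
    rw [this, rangeAvg_const hq.pos, zero_sub, abs_neg, abs_of_nonneg (by positivity), add_zero]

theorem sum_one_div_sq_le {P : Finset ℕ} {z Y : ℕ} (hz : 0 < z) (hP : P ⊆ Finset.Ioc z Y) :
    ∑ q ∈ P, 1 / (q : ℝ) ^ 2 ≤ 1 / (z : ℝ) := by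
  rcases le_total z Y with h | h
  · refine (Finset.sum_le_sum_of_subset_of_nonneg hP fun _ _ _ => by positivity).trans ?_
    have := sum_Ioc_inv_sq_le_sub (α := ℝ) hz.ne' h
    simp only [one_div]
    refine this.trans ?_
    have : (0 : ℝ) ≤ (Y : ℝ)⁻¹ := by positivity
    linarith
  · have : P = ∅ := by
      rw [Finset.Ioc_eq_empty (by omega)] at hP
      exact Finset.subset_empty.1 hP
    simp [this]

theorem card_primeFactors_le_of_lt_two_pow {m b : ℕ} (hm : m ≠ 0) (hb : m < 2 ^ b) :
    m.primeFactors.card ≤ b := by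
  have h1 : 2 ^ m.primeFactors.card ≤ m := by
    calc 2 ^ m.primeFactors.card ≤ ∏ q ∈ m.primeFactors, q :=
          Finset.pow_card_le_prod _ _ _ fun q hq => (Nat.prime_of_mem_primeFactors hq).two_le
      _ ≤ m := Nat.le_of_dvd (Nat.pos_of_ne_zero hm) (Nat.prod_primeFactors_dvd m)
  exact (Nat.pow_lt_pow_iff_right (by norm_num)).1 (h1.trans_lt hb) |>.le

/-- Error term in the comparison of the average of a phase along a linear form with its
independent model. -/
def modelError (Y z a b J R : ℕ) (H τ : ℝ) : ℝ :=
  6 * (2 * (Y : ℝ) ^ 2) ^ (2 * J) / R + 4 * Real.exp (1 + 32 * τ ^ 2 * H) / 4 ^ J +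
    2 * |τ| / 2 ^ a + τ ^ 2 * (1 + 2 * b) / z

theorem sum_ite_eq_one_div_le (P : Finset ℕ) (p : ℕ) :
    ∑ q ∈ P, (if q = p then 1 / (q : ℝ) else 0) ≤ 1 / p := by
  rw [Finset.sum_ite_eq']
  split_ifs
  · rfl
  · positivity

theorem sum_ite_dvd_one_div_le {P : Finset ℕ} {z Y m b : ℕ} (hz : 0 < z)
    (hP : P ⊆ Finset.Ioc z Y) (hprime : ∀ q ∈ P, q.Prime) (hm : m ≠ 0) (hb : m < 2 ^ b) :
    ∑ q ∈ P, (if q ∣ m then 1 / (q : ℝ) else 0) ≤ b / z := by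
  have hz' : (0 : ℝ) < z := by exact_mod_cast hz
  rw [← Finset.sum_filter]
  calc ∑ q ∈ P with q ∣ m, 1 / (q : ℝ) ≤ ∑ q ∈ P with q ∣ m, 1 / (z : ℝ) := by
        refine Finset.sum_le_sum fun q hq => ?_
        have : z < q := (Finset.mem_Ioc.1 (hP (Finset.mem_filter.1 hq).1)).1
        have : (z : ℝ) ≤ q := by exact_mod_cast this.le
        exact one_div_le_one_div_of_le hz' this
    _ = ((P.filter (· ∣ m)).card : ℝ) / z := by
        rw [Finset.sum_const, nsmul_eq_mul]; ring
    _ ≤ b / z := by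
        gcongr
        refine le_trans (Finset.card_le_card fun q hq => ?_)
          (card_primeFactors_le_of_lt_two_pow hm hb)
        rw [Finset.mem_filter] at hq
        exact Nat.mem_primeFactors.2 ⟨hprime q hq.1, hq.2, hm⟩

theorem norm_rangeAvg_linearForms_sub_le {P : Finset ℕ} {z Y a b p p' k J R : ℕ} {α β τ H : ℝ}
    (hz : 0 < z) (hY : 1 ≤ Y) (hP : P ⊆ Finset.Ioc z Y) (hprime : ∀ q ∈ P, q.Prime)
    (hH : ∑ q ∈ P, 1 / (q : ℝ) ≤ H) (hτ : |τ| ≤ 1 / 4) (hα : |α| ≤ 1) (hβ : |β| ≤ 1)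
    (hp : p.Prime) (hp' : p'.Prime) (hne : p ≠ p') (hap : 2 ^ a ≤ p) (hap' : 2 ^ a ≤ p')
    (hpb : p < 2 ^ b) (hpb' : p' < 2 ^ b) (hk : 0 < k) (hkp : k < p) (hkp' : k < p')
    (hR : 0 < R) :
    ‖rangeAvg R (fun r => Complex.exp (Complex.I * ((τ * ∑ q ∈ P,
        (α * (dvdInd p k q r - 1 / q) + β * (dvdInd p' k q r - 1 / q)) : ℝ) : ℂ))) -
      ∏ q ∈ P, bernoulliFactor q (α * τ) * bernoulliFactor q (β * τ)‖ ≤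
    modelError Y z a b J R H τ := by
  set g : ℕ → ℕ → ℝ := fun q r => α * (dvdInd p k q r - 1 / q) + β * (dvdInd p' k q r - 1 / q)
    with hg
  set δ : ℕ → ℝ := fun q => (if q = p then 1 / (q : ℝ) else 0) + if q = p' then 1 / (q : ℝ) else 0
    with hδ
  set B : ℕ → ℝ := fun q => 1 / (q : ℝ) ^ 2 +
    if q ∣ k * ((p : ℤ) - p').natAbs then 1 / (q : ℝ) else 0 with hB
  have hδ0 : ∀ q, 0 ≤ δ q := fun q => by simp only [hδ]; positivity
  have hδsum : ∑ q ∈ P, δ q ≤ 2 / 2 ^ a := by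
    rw [hδ, Finset.sum_add_distrib]
    have h1 := sum_ite_eq_one_div_le P p
    have h2 := sum_ite_eq_one_div_le P p'
    have h3 : 1 / (p : ℝ) ≤ 1 / 2 ^ a :=
      one_div_le_one_div_of_le (by positivity) (by exact_mod_cast hap)
    have h4 : 1 / (p' : ℝ) ≤ 1 / 2 ^ a :=
      one_div_le_one_div_of_le (by positivity) (by exact_mod_cast hap')
    have : (2 : ℝ) / 2 ^ a = 1 / 2 ^ a + 1 / 2 ^ a := by ring
    linarith
  have hBsum : ∑ q ∈ P, B q ≤ (1 + 2 * b) / z := by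
    rw [hB, Finset.sum_add_distrib]
    have hD0 : ((p : ℤ) - p').natAbs ≠ 0 := by omega
    have hD1 : ((p : ℤ) - p').natAbs < 2 ^ b := by omega
    have hD : k * ((p : ℤ) - p').natAbs < 2 ^ (2 * b) := by
      rw [two_mul, pow_add]
      exact Nat.mul_lt_mul'' (hkp.trans hpb) hD1
    have h1 := sum_one_div_sq_le hz hP
    have h2 := sum_ite_dvd_one_div_le hz hP hprime (mul_ne_zero hk.ne' hD0) hD
    push_cast at h2
    rw [add_div]
    exact add_le_add h1 h2
  have hbd : ∀ q ∈ P, ∀ r, |g q r| ≤ 2 := by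
    intro q hq r
    have hq1 : (1 : ℝ) ≤ q := by exact_mod_cast (hprime q hq).one_le
    have h0 : 0 ≤ 1 / (q : ℝ) := by positivity
    have h1 : 1 / (q : ℝ) ≤ 1 := by rw [div_le_one (by linarith)]; exact hq1
    have h2 : ∀ p, |dvdInd p k q r - 1 / q| ≤ 1 := by
      intro p
      rcases dvdInd_eq p k q r with h | h <;> rw [h, abs_le] <;> constructor <;> linarith
    refine (abs_add_le _ _).trans ?_
    rw [abs_mul, abs_mul]
    have := mul_le_mul hα (h2 p) (abs_nonneg _) zero_le_one
    have := mul_le_mul hβ (h2 p') (abs_nonneg _) zero_le_one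
    linarith
  have hper : ∀ q ∈ P, Function.Periodic (g q) q := by
    intro q _ r
    simp only [hg, periodic_dvdInd p k q r, periodic_dvdInd p' k q r]
  have hdiff : ∀ q ∈ P, |rangeAvg q (dvdInd p k q) - 1 / q| + |rangeAvg q (dvdInd p' k q) - 1 / q| ≤
      δ q := by
    intro q hq
    rw [rangeAvg_dvdInd hp (hprime q hq) hk hkp, rangeAvg_dvdInd hp' (hprime q hq) hk hkp',
      sub_sub_cancel_left, sub_sub_cancel_left, abs_neg, abs_neg, abs_of_nonneg, abs_of_nonneg]
    · positivity
    · positivity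
  have hmean : ∀ q ∈ P, |rangeAvg q (g q)| ≤ δ q := by
    intro q hq
    have hq0 := (hprime q hq).pos
    have : rangeAvg q (g q) = α * (rangeAvg q (dvdInd p k q) - 1 / q) +
        β * (rangeAvg q (dvdInd p' k q) - 1 / q) := by
      simp only [hg]
      rw [rangeAvg_add, rangeAvg_const_mul, rangeAvg_const_mul, rangeAvg_sub, rangeAvg_sub,
        rangeAvg_const hq0]
    rw [this]
    refine le_trans ((abs_add_le _ _).trans ?_) (hdiff q hq)
    rw [abs_mul, abs_mul]
    exact add_le_add (mul_le_of_le_one_left (abs_nonneg _) hα)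
      (mul_le_of_le_one_left (abs_nonneg _) hβ)
  have hvar1 : ∀ p : ℕ, p.Prime → k < p → ∀ q ∈ P,
      rangeAvg q (fun r => (dvdInd p k q r - 1 / q) ^ 2) ≤ 2 / (q : ℝ) := by
    intro p hp hkp q hq
    have hq0 := (hprime q hq).pos
    have hq1 : (1 : ℝ) ≤ q := by exact_mod_cast (hprime q hq).one_le
    have h1 : ∀ r, (dvdInd p k q r - 1 / q) ^ 2 ≤ dvdInd p k q r + 1 / q := by
      intro r
      have h0 : 0 ≤ 1 / (q : ℝ) := by positivity
      have h1 : 1 / (q : ℝ) ≤ 1 := by rw [div_le_one (by linarith)]; exact hq1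
      rcases dvdInd_eq p k q r with h | h <;> rw [h] <;> nlinarith
    refine (rangeAvg_mono q h1).trans ?_
    rw [rangeAvg_add, rangeAvg_const hq0, rangeAvg_dvdInd hp (hprime q hq) hk hkp]
    have : (0 : ℝ) ≤ if q = p then 1 / (q : ℝ) else 0 := by positivity
    have : (2 : ℝ) / q = 1 / q + 1 / q := by ring
    linarith
  have hvar : ∀ q ∈ P, rangeAvg q (fun r => g q r ^ 2) ≤ 8 / (q : ℝ) := by
    intro q hq
    have hsq : ∀ x : ℝ, |x| ≤ 1 → x ^ 2 ≤ 1 := fun x hx => (sq_le_one_iff_abs_le_one x).2 hx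
    have h1 : ∀ r, g q r ^ 2 ≤ 2 * (dvdInd p k q r - 1 / q) ^ 2 +
        2 * (dvdInd p' k q r - 1 / q) ^ 2 := by
      intro r
      simp only [hg]
      have h2 := mul_le_of_le_one_left (sq_nonneg (dvdInd p k q r - 1 / q)) (hsq α hα)
      have h3 := mul_le_of_le_one_left (sq_nonneg (dvdInd p' k q r - 1 / q)) (hsq β hβ)
      nlinarith [sq_nonneg (α * (dvdInd p k q r - 1 / q) - β * (dvdInd p' k q r - 1 / q))]
    refine (rangeAvg_mono q h1).trans ?_
    rw [rangeAvg_add, rangeAvg_const_mul, rangeAvg_const_mul]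
    have h4 := hvar1 p hp hkp q hq
    have h5 := hvar1 p' hp' hkp' q hq
    have : (8 : ℝ) / q = 2 * (2 / q) + 2 * (2 / q) := by ring
    linarith
  have hvarsum : ∑ q ∈ P, 8 / (q : ℝ) ≤ 8 * H := by
    calc ∑ q ∈ P, 8 / (q : ℝ) = 8 * ∑ q ∈ P, 1 / (q : ℝ) := by
          rw [Finset.mul_sum]; exact Finset.sum_congr rfl fun q _ => by ring
      _ ≤ 8 * H := by linarith
  have hmgf : ∀ s : ℝ, |s| = 2 * |τ| → rangeAvg (∏ q ∈ P, q)
      (fun r => Real.exp (s * ∑ q ∈ P, g q r)) ≤ Real.exp (1 + 32 * τ ^ 2 * H) := by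
    intro s hs
    refine (rangeAvg_exp_sum_le hprime hper hbd (by linarith) hmean hvar).trans ?_
    rw [Real.exp_le_exp]
    have h2a : (2 : ℝ) / 2 ^ a ≤ 2 := div_le_self (by norm_num) (one_le_pow₀ (by norm_num))
    have hs2 : s ^ 2 = 4 * τ ^ 2 := by rw [← sq_abs, hs, mul_pow, sq_abs]; norm_num
    have h0 : 0 ≤ ∑ q ∈ P, δ q := Finset.sum_nonneg fun q _ => hδ0 q
    have h1 : |s| * ∑ q ∈ P, δ q ≤ 1 / 2 * 2 := by
      refine mul_le_mul (by linarith) (hδsum.trans h2a) h0 (by norm_num)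
    have h2 : s ^ 2 * ∑ q ∈ P, 8 / (q : ℝ) ≤ 4 * τ ^ 2 * (8 * H) := by
      rw [hs2]; gcongr
    linarith
  have hmain := norm_rangeAvg_exp_sub_le hprime hY
    (fun q hq => (Finset.mem_Ioc.1 (hP hq)).2) hper hbd hR J (τ := τ) (by linarith)
    (hmgf (2 * τ) (by rw [abs_mul, abs_two])) (hmgf (-(2 * τ)) (by rw [abs_neg, abs_mul, abs_two]))
  have hprod : rangeAvg (∏ q ∈ P, q) (fun r => Complex.exp (Complex.I *
      ((τ * ∑ q ∈ P, g q r : ℝ) : ℂ))) =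
      ∏ q ∈ P, rangeAvg q (fun r => Complex.exp (Complex.I * ((τ * g q r : ℝ) : ℂ))) := by
    rw [← rangeAvg_prod_of_prime hprime]
    · congr 1; funext r
      rw [← Complex.exp_sum, ← Finset.mul_sum]
      congr 2
      rw [Finset.mul_sum]; push_cast; rfl
    · intro q hq r
      simp only [hper q hq r]
  have hbnd1 : ∀ q ∈ P, ‖bernoulliFactor q (α * τ) * bernoulliFactor q (β * τ)‖ ≤ 1 := by
    intro q hq
    rw [norm_mul]
    exact mul_le_one₀ (norm_bernoulliFactor_le (hprime q hq).pos _) (norm_nonneg _)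
      (norm_bernoulliFactor_le (hprime q hq).pos _)
  have hlocal : ‖∏ q ∈ P, rangeAvg q (fun r => Complex.exp (Complex.I * ((τ * g q r : ℝ) : ℂ))) -
      ∏ q ∈ P, bernoulliFactor q (α * τ) * bernoulliFactor q (β * τ)‖ ≤
      |τ| * (2 / 2 ^ a) + τ ^ 2 * ((1 + 2 * b) / z) := by
    refine (norm_prod_sub_prod_le P _ _ (fun q _ => norm_rangeAvg_le_of_forall _ fun r =>
      (norm_exp_I_mul_ofReal _).le) hbnd1).trans ?_
    calc _ ≤ ∑ q ∈ P, (|τ| * δ q + τ ^ 2 * B q) := by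
          refine Finset.sum_le_sum fun q hq => ?_
          refine (norm_rangeAvg_exp_sub_bernoulliFactor_le (hprime q hq).pos
            (dvdInd_eq p k q) (dvdInd_eq p' k q) hα hβ τ).trans ?_
          gcongr
          · exact hdiff q hq
          · exact abs_rangeAvg_dvdInd_mul_sub_le hp (hprime q hq) hk hkp
      _ = |τ| * ∑ q ∈ P, δ q + τ ^ 2 * ∑ q ∈ P, B q := by
          rw [Finset.sum_add_distrib, Finset.mul_sum, Finset.mul_sum]
      _ ≤ _ := by gcongr
  rw [hprod] at hmain
  refine (norm_sub_le_norm_sub_add_norm_sub _ _ _).trans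
    ((add_le_add hmain hlocal).trans_eq ?_)
  rw [modelError]; ring

/-- The centred phase `exp (iτ ∑ (1_{q ∣ m} - 1/q))`. -/
def centeredPhase (P : Finset ℕ) (τ : ℝ) (m : ℕ) : ℂ :=
  Complex.exp (Complex.I * ((τ * ∑ q ∈ P, ((if q ∣ m then 1 else 0) - 1 / (q : ℝ)) : ℝ) : ℂ))

/-- The mean of `centeredPhase` in the independent model. -/
def modelPhase (P : Finset ℕ) (τ : ℝ) : ℂ := ∏ q ∈ P, bernoulliFactor q τ

theorem norm_rangeAvg_correlation_le {P : Finset ℕ} {z Y a b p p' k J R : ℕ} {τ H : ℝ}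
    (hz : 0 < z) (hY : 1 ≤ Y) (hP : P ⊆ Finset.Ioc z Y) (hprime : ∀ q ∈ P, q.Prime)
    (hH : ∑ q ∈ P, 1 / (q : ℝ) ≤ H) (hτ : |τ| ≤ 1 / 4)
    (hp : p.Prime) (hp' : p'.Prime) (hne : p ≠ p') (hap : 2 ^ a ≤ p) (hap' : 2 ^ a ≤ p')
    (hpb : p < 2 ^ b) (hpb' : p' < 2 ^ b) (hk : 0 < k) (hkp : k < p) (hkp' : k < p')
    (hR : 0 < R) :
    ‖rangeAvg R (fun r => (centeredPhase P τ (p * (r + 1) + k) - modelPhase P τ) *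
      (starRingEnd ℂ) (centeredPhase P τ (p' * (r + 1) + k) - modelPhase P τ))‖ ≤
    3 * modelError Y z a b J R H τ := by
  set c := modelPhase P τ with hc
  set f : ℕ → ℂ := fun r => centeredPhase P τ (p * (r + 1) + k) with hf
  set f' : ℕ → ℂ := fun r => centeredPhase P τ (p' * (r + 1) + k) with hf'
  set ε := modelError Y z a b J R H τ
  have hcn : ‖c‖ ≤ 1 := by
    rw [hc, modelPhase, norm_prod]
    exact Finset.prod_le_one (fun q _ => norm_nonneg _)
      fun q hq => norm_bernoulliFactor_le (hprime q hq).pos _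
  have hconj : (starRingEnd ℂ) c = ∏ q ∈ P, bernoulliFactor q (-τ) := by
    simp only [hc, modelPhase, map_prod, conj_bernoulliFactor]
  have hzero : ∀ q, bernoulliFactor q 0 = 1 := fun q => by simp [bernoulliFactor]
  have key : ∀ α β : ℝ, |α| ≤ 1 → |β| ≤ 1 → _ := fun α β hα hβ =>
    norm_rangeAvg_linearForms_sub_le (J := J) hz hY hP hprime hH hτ hα hβ hp hp' hne hap hap' hpb
      hpb' hk hkp hkp' hR
  have h1 := key 1 (-1) (by simp) (by simp)
  have h2 := key 1 0 (by simp) (by simp)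
  have h3 := key 0 (-1) (by simp) (by simp)
  have e1 : (fun r => Complex.exp (Complex.I * ((τ * ∑ q ∈ P,
        (1 * (dvdInd p k q r - 1 / q) + -1 * (dvdInd p' k q r - 1 / q)) : ℝ) : ℂ))) =
      fun r => f r * (starRingEnd ℂ) (f' r) := by
    funext r
    simp only [hf, hf', centeredPhase, ← Complex.exp_conj, map_mul, Complex.conj_I,
      Complex.conj_ofReal]
    rw [← Complex.exp_add]
    congr 1
    simp only [dvdInd, Finset.sum_add_distrib, ← Finset.mul_sum]
    push_cast; ring
  have e2 : (fun r => Complex.exp (Complex.I * ((τ * ∑ q ∈ P,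
        (1 * (dvdInd p k q r - 1 / q) + 0 * (dvdInd p' k q r - 1 / q)) : ℝ) : ℂ))) = f := by
    funext r
    simp only [hf, centeredPhase, dvdInd, one_mul, zero_mul, add_zero]
  have e3 : (fun r => Complex.exp (Complex.I * ((τ * ∑ q ∈ P,
        (0 * (dvdInd p k q r - 1 / q) + -1 * (dvdInd p' k q r - 1 / q)) : ℝ) : ℂ))) =
      fun r => (starRingEnd ℂ) (f' r) := by
    funext r
    simp only [hf', centeredPhase, ← Complex.exp_conj, map_mul, Complex.conj_I,
      Complex.conj_ofReal]
    congr 1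
    simp only [dvdInd, Finset.sum_add_distrib, ← Finset.mul_sum]
    push_cast; ring
  rw [e1, Finset.prod_mul_distrib] at h1
  rw [e2] at h2
  rw [e3] at h3
  simp only [one_mul, neg_mul, zero_mul, hzero, mul_one, ← hconj] at h1 h2 h3
  change ‖_ - c * _‖ ≤ _ at h1
  change ‖_ - c‖ ≤ _ at h2
  have expand : (fun r => (f r - c) * (starRingEnd ℂ) (f' r - c)) = fun r =>
      f r * (starRingEnd ℂ) (f' r) - (starRingEnd ℂ) c * f r - c * (starRingEnd ℂ) (f' r) +
        c * (starRingEnd ℂ) c := by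
    funext r; rw [map_sub]; ring
  rw [expand, rangeAvg_add, rangeAvg_sub, rangeAvg_sub, rangeAvg_const_mul, rangeAvg_const_mul,
    rangeAvg_const hR]
  have : rangeAvg R (fun r => f r * (starRingEnd ℂ) (f' r)) - (starRingEnd ℂ) c * rangeAvg R f -
      c * rangeAvg R (fun r => (starRingEnd ℂ) (f' r)) + c * (starRingEnd ℂ) c =
      (rangeAvg R (fun r => f r * (starRingEnd ℂ) (f' r)) - c * (starRingEnd ℂ) c) -
      (starRingEnd ℂ) c * (rangeAvg R f - c) -
      c * (rangeAvg R (fun r => (starRingEnd ℂ) (f' r)) - (starRingEnd ℂ) c) := by ring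
  rw [this]
  have hcn' : ‖(starRingEnd ℂ) c‖ ≤ 1 := by rwa [RCLike.norm_conj]
  refine (norm_sub_le _ _).trans ?_
  have g1 : ‖c * (rangeAvg R (fun r => (starRingEnd ℂ) (f' r)) - (starRingEnd ℂ) c)‖ ≤ ε := by
    rw [norm_mul]; exact (mul_le_of_le_one_left (norm_nonneg _) hcn).trans h3
  have g2 : ‖(starRingEnd ℂ) c * (rangeAvg R f - c)‖ ≤ ε := by
    rw [norm_mul]; exact (mul_le_of_le_one_left (norm_nonneg _) hcn').trans h2
  have g3 := norm_sub_le (rangeAvg R (fun r => f r * (starRingEnd ℂ) (f' r)) -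
    c * (starRingEnd ℂ) c) ((starRingEnd ℂ) c * (rangeAvg R f - c))
  linarith

theorem card_filter_dvd_Icc (N d : ℕ) :
    ((Finset.Icc 1 N).filter (d ∣ ·)).card = N / d := by
  have : Finset.Icc 1 N = Finset.Ioc 0 N := by ext; simp [Nat.succ_le_iff]
  rw [this, Nat.Ioc_filter_dvd_card_eq_div]

theorem natCast_div_le_mul_one_div (N d : ℕ) : ((N / d : ℕ) : ℝ) ≤ N * (1 / d) := by
  rw [mul_one_div]; exact Nat.cast_div_le

theorem sum_card_primeFactors_le {M N : ℕ} (hMN : M ≤ N) {H : ℝ}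
    (hH : ∑ p ∈ (Finset.range (N + 1)).filter Nat.Prime, 1 / (p : ℝ) ≤ H) :
    ∑ r ∈ Finset.Icc 1 M, (r.primeFactors.card : ℝ) ≤ M * H := by
  have h1 : ∀ r ∈ Finset.Icc 1 M, (r.primeFactors.card : ℝ) ≤
      ∑ p ∈ (Finset.range (N + 1)).filter Nat.Prime, if p ∣ r then (1 : ℝ) else 0 := by
    intro r hr
    rw [Finset.mem_Icc] at hr
    rw [← Finset.sum_filter, Finset.sum_const, nsmul_eq_mul, mul_one]
    refine Nat.cast_le.2 (Finset.card_le_card fun p hp => ?_)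
    have h2 := Nat.mem_primeFactors.1 hp
    have h3 := Nat.le_of_dvd (by omega) h2.2.1
    simp only [Finset.mem_filter, Finset.mem_range]
    exact ⟨⟨by omega, h2.1⟩, h2.2.1⟩
  calc _ ≤ ∑ r ∈ Finset.Icc 1 M, ∑ p ∈ (Finset.range (N + 1)).filter Nat.Prime,
        (if p ∣ r then (1 : ℝ) else 0) := Finset.sum_le_sum h1
    _ = ∑ p ∈ (Finset.range (N + 1)).filter Nat.Prime, ((M / p : ℕ) : ℝ) := by
        rw [Finset.sum_comm]
        refine Finset.sum_congr rfl fun p _ => ?_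
        rw [← Finset.sum_filter, Finset.sum_const, nsmul_eq_mul, mul_one, card_filter_dvd_Icc]
    _ ≤ ∑ p ∈ (Finset.range (N + 1)).filter Nat.Prime, (M : ℝ) * (1 / p) :=
        Finset.sum_le_sum fun p _ => natCast_div_le_mul_one_div M p
    _ ≤ M * H := by rw [← Finset.mul_sum]; gcongr

theorem card_primeFactors_prime_mul {p r : ℕ} (hp : p.Prime) (hr : r ≠ 0) (hpr : ¬ p ∣ r) :
    (p * r).primeFactors.card = r.primeFactors.card + 1 := by
  rw [Nat.primeFactors_mul hp.ne_zero hr, hp.primeFactors, Finset.singleton_union,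
    Finset.card_insert_of_notMem]
  exact fun h => hpr (Nat.dvd_of_mem_primeFactors h)

/-- **Turán–Kubilius inequality** for the number of prime divisors in a set of primes. -/
theorem turan_kubilius {Q : Finset ℕ} (hQ : ∀ p ∈ Q, p.Prime) (N : ℕ) :
    ∑ n ∈ Finset.Icc 1 N, (((Q.filter (· ∣ n)).card : ℝ) - ∑ p ∈ Q, 1 / (p : ℝ)) ^ 2 ≤
      (∑ p ∈ Q, 1 / (p : ℝ)) * (N + 2 * Q.card) := by
  set S := ∑ p ∈ Q, 1 / (p : ℝ) with hS
  have hS0 : 0 ≤ S := Finset.sum_nonneg fun _ _ => by positivity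
  set W : ℕ → ℝ := fun n => ∑ p ∈ Q, if p ∣ n then (1 : ℝ) else 0 with hW
  have hWn : ∀ n, ((Q.filter (· ∣ n)).card : ℝ) = W n := by
    intro n; simp [hW]
  have hcount : ∀ d : ℕ, ∑ n ∈ Finset.Icc 1 N, (if d ∣ n then (1 : ℝ) else 0) = (N / d : ℕ) := by
    intro d
    rw [← Finset.sum_filter, Finset.sum_const, nsmul_eq_mul, mul_one, card_filter_dvd_Icc]
  have h1 : N * S - Q.card ≤ ∑ n ∈ Finset.Icc 1 N, W n := by
    rw [hW, Finset.sum_comm]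
    simp only [hcount]
    have : (Q.card : ℝ) = ∑ p ∈ Q, (1 : ℝ) := by simp
    rw [hS, Finset.mul_sum, this, ← Finset.sum_sub_distrib]
    refine Finset.sum_le_sum fun p hp => ?_
    have := Nat.lt_floor_add_one ((N : ℝ) / p)
    rw [Nat.floor_div_eq_div] at this
    rw [mul_one_div]; linarith
  have h2 : ∑ n ∈ Finset.Icc 1 N, W n ^ 2 ≤ N * S + N * S ^ 2 := by
    have h3 : ∀ n, W n ^ 2 = ∑ p ∈ Q, ∑ p' ∈ Q,
        (if p ∣ n then (1 : ℝ) else 0) * (if p' ∣ n then (1 : ℝ) else 0) := by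
      intro n; rw [sq, hW, Finset.sum_mul_sum]
    simp only [h3]
    rw [Finset.sum_comm]
    have h4 : ∀ p ∈ Q, ∑ n ∈ Finset.Icc 1 N, ∑ p' ∈ Q,
        (if p ∣ n then (1 : ℝ) else 0) * (if p' ∣ n then (1 : ℝ) else 0) ≤
        N * (1 / p) + N * ((1 / p) * S) := by
      intro p hp
      rw [Finset.sum_comm, ← Finset.add_sum_erase _ _ hp]
      refine add_le_add ?_ ?_
      · have : ∀ n, (if p ∣ n then (1 : ℝ) else 0) * (if p ∣ n then (1 : ℝ) else 0) =
            if p ∣ n then (1 : ℝ) else 0 := by intro n; split_ifs <;> simp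
        simp only [this, hcount]
        exact natCast_div_le_mul_one_div N p
      · calc _ ≤ ∑ p' ∈ Q.erase p, (N : ℝ) * ((1 / p) * (1 / p')) := by
              refine Finset.sum_le_sum fun p' hp' => ?_
              rw [Finset.mem_erase] at hp'
              have hc : p.Coprime p' := (Nat.coprime_primes (hQ p hp) (hQ p' hp'.2)).2 hp'.1.symm
              have : ∀ n, (if p ∣ n then (1 : ℝ) else 0) * (if p' ∣ n then (1 : ℝ) else 0) =
                  if p * p' ∣ n then (1 : ℝ) else 0 := by
                intro n
                by_cases ha : p ∣ n <;> by_cases hb : p' ∣ n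
                · simp [ha, hb, hc.mul_dvd_of_dvd_of_dvd ha hb]
                · have : ¬ p * p' ∣ n := fun h => hb (dvd_of_mul_left_dvd h)
                  simp [ha, hb, this]
                · have : ¬ p * p' ∣ n := fun h => ha (dvd_of_mul_right_dvd h)
                  simp [ha, hb, this]
                · have : ¬ p * p' ∣ n := fun h => ha (dvd_of_mul_right_dvd h)
                  simp [ha, hb, this]
              simp only [this, hcount]
              refine (natCast_div_le_mul_one_div N _).trans_eq ?_
              push_cast; ring
          _ ≤ ∑ p' ∈ Q, (N : ℝ) * ((1 / p) * (1 / p')) :=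
              Finset.sum_le_sum_of_subset_of_nonneg (Finset.erase_subset _ _)
                fun _ _ _ => by positivity
          _ = N * ((1 / p) * S) := by rw [hS, Finset.mul_sum, Finset.mul_sum]
    refine (Finset.sum_le_sum h4).trans_eq ?_
    rw [Finset.sum_add_distrib, ← Finset.mul_sum, ← Finset.mul_sum, ← Finset.sum_mul, ← hS]
    ring
  have h5 : ∑ n ∈ Finset.Icc 1 N, (W n - S) ^ 2 =
      ∑ n ∈ Finset.Icc 1 N, W n ^ 2 - 2 * S * ∑ n ∈ Finset.Icc 1 N, W n + N * S ^ 2 := by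
    rw [Finset.mul_sum, ← Finset.sum_sub_distrib]
    have : (N : ℝ) * S ^ 2 = ∑ n ∈ Finset.Icc 1 N, S ^ 2 := by simp
    rw [this, ← Finset.sum_add_distrib]
    exact Finset.sum_congr rfl fun n _ => by ring
  simp only [hWn]
  rw [h5]
  nlinarith [mul_le_mul_of_nonneg_left h1 hS0]

theorem sum_mul_card_filter_dvd (Q : Finset ℕ) (hQ : ∀ p ∈ Q, 0 < p) (N : ℕ) (F : ℕ → ℂ) :
    ∑ n ∈ Finset.Icc 1 N, F n * ((Q.filter (· ∣ n)).card : ℂ) =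
      ∑ p ∈ Q, ∑ r ∈ Finset.Icc 1 (N / p), F (p * r) := by
  have h1 : ∀ n, F n * ((Q.filter (· ∣ n)).card : ℂ) = ∑ p ∈ Q, if p ∣ n then F n else 0 := by
    intro n
    rw [← Finset.sum_filter, Finset.sum_const, nsmul_eq_mul, mul_comm]
  simp only [h1]
  rw [Finset.sum_comm]
  refine Finset.sum_congr rfl fun p hp => ?_
  have hp0 := hQ p hp
  rw [← Finset.sum_filter]
  symm
  refine Finset.sum_bij (fun r _ => p * r) ?_ ?_ ?_ ?_
  · intro r hr
    rw [Finset.mem_Icc] at hr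
    rw [Finset.mem_filter, Finset.mem_Icc]
    refine ⟨⟨Nat.mul_pos hp0 hr.1, ?_⟩, Dvd.intro _ rfl⟩
    rw [mul_comm]; exact (Nat.le_div_iff_mul_le hp0).1 hr.2
  · intro r _ r' _ h
    exact Nat.eq_of_mul_eq_mul_left hp0 h
  · intro n hn
    rw [Finset.mem_filter, Finset.mem_Icc] at hn
    obtain ⟨r, rfl⟩ := hn.2
    refine ⟨r, ?_, rfl⟩
    rw [Finset.mem_Icc]
    refine ⟨Nat.pos_of_ne_zero fun h => by simp [h] at hn, ?_⟩
    rw [Nat.le_div_iff_mul_le hp0, mul_comm]; exact hn.1.2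
  · intros; rfl

/-- Second moment of a bilinear sum, for a fixed shift `k`. -/
theorem sum_norm_sq_bilinear_le {Q : Finset ℕ} {i N k : ℕ} {G : ℕ → ℂ} {ε : ℝ} (hε : 0 ≤ ε)
    (hQ : ∀ p ∈ Q, 2 ^ i ≤ p) (hcard : Q.card ≤ 2 ^ i) (hG : ∀ n, ‖G n‖ ≤ 2)
    (hcorr : ∀ p ∈ Q, ∀ p' ∈ Q, p ≠ p' →
      ‖∑ r ∈ Finset.Icc 1 (N / max p p'), G (p * r + k) * (starRingEnd ℂ) (G (p' * r + k))‖ ≤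
        ε * (N / max p p' : ℕ)) :
    ∑ r ∈ Finset.Icc 1 (N / 2 ^ i),
      ‖∑ p ∈ Q, if p * r ≤ N then G (p * r + k) else 0‖ ^ 2 ≤ N * (4 + 2 ^ i * ε) := by
  set M := N / 2 ^ i with hM
  set f : ℕ → ℕ → ℂ := fun p r => if p * r ≤ N then G (p * r + k) else 0 with hf
  have hMN : (2 : ℝ) ^ i * M ≤ N := by
    have := Nat.div_mul_le_self N (2 ^ i)
    rw [mul_comm]; exact_mod_cast this
  have hcard' : (Q.card : ℝ) ≤ 2 ^ i := by exact_mod_cast hcard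
  have hfn : ∀ p r, ‖f p r‖ ≤ 2 := by
    intro p r; simp only [hf]; split_ifs
    · exact hG _
    · simp
  have h1 : ((∑ r ∈ Finset.Icc 1 M, ‖∑ p ∈ Q, f p r‖ ^ 2 : ℝ) : ℂ) =
      ∑ p ∈ Q, ∑ p' ∈ Q, ∑ r ∈ Finset.Icc 1 M, f p r * (starRingEnd ℂ) (f p' r) := by
    push_cast
    have : ∀ r, ((‖∑ p ∈ Q, f p r‖ : ℂ)) ^ 2 =
        ∑ p ∈ Q, ∑ p' ∈ Q, f p r * (starRingEnd ℂ) (f p' r) := by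
      intro r
      rw [← Complex.mul_conj', map_sum, Finset.sum_mul_sum]
    simp only [this]
    rw [Finset.sum_comm]
    exact Finset.sum_congr rfl fun p _ => Finset.sum_comm
  have h2 : ∀ p ∈ Q, ∀ p' ∈ Q, ‖∑ r ∈ Finset.Icc 1 M, f p r * (starRingEnd ℂ) (f p' r)‖ ≤
      (if p = p' then 4 * (M : ℝ) else 0) + ε * M := by
    intro p hp p' hp'
    split_ifs with h
    · refine le_add_of_le_of_nonneg ?_ (by positivity)
      refine (norm_sum_le _ _).trans ((Finset.sum_le_card_nsmul _ _ 4 fun r _ => ?_).trans ?_)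
      · rw [norm_mul, RCLike.norm_conj]
        nlinarith [hfn p r, hfn p' r, norm_nonneg (f p r), norm_nonneg (f p' r)]
      · simp [mul_comm]
    · rw [zero_add]
      have hpos : 0 < 2 ^ i := by positivity
      have hmax : 2 ^ i ≤ max p p' := (hQ p hp).trans (le_max_left _ _)
      have hle : N / max p p' ≤ M := Nat.div_le_div_left hmax hpos
      have h3 : ∑ r ∈ Finset.Icc 1 M, f p r * (starRingEnd ℂ) (f p' r) =
          ∑ r ∈ Finset.Icc 1 (N / max p p'), G (p * r + k) * (starRingEnd ℂ) (G (p' * r + k)) := by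
        have hsub : Finset.Icc 1 (N / max p p') ⊆ Finset.Icc 1 M :=
          Finset.Icc_subset_Icc_right hle
        rw [← Finset.sum_subset hsub]
        · refine Finset.sum_congr rfl fun r hr => ?_
          have h4 := (Nat.le_div_iff_mul_le (hpos.trans_le hmax)).1 (Finset.mem_Icc.1 hr).2
          have h5 : p * r ≤ N := by
            refine le_trans ?_ h4; rw [mul_comm]; gcongr; exact le_max_left _ _
          have h6 : p' * r ≤ N := by
            refine le_trans ?_ h4; rw [mul_comm]; gcongr; exact le_max_right _ _
          simp only [hf, if_pos h5, if_pos h6]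
        · intro r hr hr'
          have h7 : N < r * max p p' := by
            by_contra hcon
            exact hr' (Finset.mem_Icc.2 ⟨(Finset.mem_Icc.1 hr).1,
              (Nat.le_div_iff_mul_le (hpos.trans_le hmax)).2 (not_lt.1 hcon)⟩)
          rcases le_total p p' with hpp | hpp
          · rw [max_eq_right hpp, mul_comm] at h7
            simp [hf, not_le.2 h7]
          · rw [max_eq_left hpp, mul_comm] at h7
            simp [hf, not_le.2 h7]
      rw [h3]
      refine (hcorr p hp p' hp' h).trans ?_
      gcongr
  have h8 : ∑ r ∈ Finset.Icc 1 M, ‖∑ p ∈ Q, f p r‖ ^ 2 ≤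
      ∑ p ∈ Q, ∑ p' ∈ Q, ((if p = p' then 4 * (M : ℝ) else 0) + ε * M) := by
    have h0 : 0 ≤ ∑ r ∈ Finset.Icc 1 M, ‖∑ p ∈ Q, f p r‖ ^ 2 :=
      Finset.sum_nonneg fun _ _ => by positivity
    rw [← Real.norm_of_nonneg h0, ← Complex.norm_real, h1]
    refine (norm_sum_le _ _).trans (Finset.sum_le_sum fun p hp => ?_)
    exact (norm_sum_le _ _).trans (Finset.sum_le_sum fun p' hp' => h2 p hp p' hp')
  refine h8.trans ?_
  have h9 : ∑ p ∈ Q, ∑ p' ∈ Q, ((if p = p' then 4 * (M : ℝ) else 0) + ε * M) =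
      Q.card * (4 * M) + Q.card * (Q.card * (ε * M)) := by
    simp [Finset.sum_add_distrib]
  rw [h9]
  have hM0 : (0 : ℝ) ≤ M := by positivity
  calc (Q.card : ℝ) * (4 * M) + Q.card * (Q.card * (ε * M))
      ≤ 2 ^ i * (4 * M) + 2 ^ i * (2 ^ i * (ε * M)) := by gcongr
    _ = (2 ^ i * M) * (4 + 2 ^ i * ε) := by ring
    _ ≤ N * (4 + 2 ^ i * ε) := by gcongr

/-- Contribution of one dyadic block of primes. -/
theorem norm_sum_block_le {Q : Finset ℕ} {i N K : ℕ} {G : ℕ → ℂ} {ε H : ℝ} (hε : 0 ≤ ε)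
    (hK : 0 < K) (hQ : ∀ p ∈ Q, 2 ^ i ≤ p) (hcard : Q.card ≤ 2 ^ i) (hG : ∀ n, ‖G n‖ ≤ 2)
    (hcorr : ∀ p ∈ Q, ∀ p' ∈ Q, p ≠ p' → ∀ k ∈ Finset.Icc 1 K,
      ‖∑ r ∈ Finset.Icc 1 (N / max p p'), G (p * r + k) * (starRingEnd ℂ) (G (p' * r + k))‖ ≤
        ε * (N / max p p' : ℕ))
    (hH : ∑ p ∈ (Finset.range (N + 1)).filter Nat.Prime, 1 / (p : ℝ) ≤ H) :
    ‖∑ p ∈ Q, ∑ r ∈ Finset.Icc 1 (N / p), G (p * r + (r.primeFactors.card + 1))‖ ≤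
      N * (2 * H / K + √(K * (4 / 2 ^ i + ε))) := by
  set M := N / 2 ^ i with hM
  have hpos : 0 < 2 ^ i := by positivity
  have hKr : (0 : ℝ) < K := by exact_mod_cast hK
  set B : ℕ → ℕ → ℂ := fun k r => ∑ p ∈ Q, if p * r ≤ N then G (p * r + k) else 0 with hB
  have hMN : (2 : ℝ) ^ i * M ≤ N := by
    have := Nat.div_mul_le_self N (2 ^ i)
    rw [mul_comm]; exact_mod_cast this
  have hcard' : (Q.card : ℝ) ≤ 2 ^ i := by exact_mod_cast hcard
  have hM0 : (0 : ℝ) ≤ M := by positivity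
  have hH0 : 0 ≤ H := le_trans (Finset.sum_nonneg fun _ _ => by positivity) hH
  have hBn : ∀ k r, ‖B k r‖ ≤ 2 * Q.card := by
    intro k r
    refine (norm_sum_le _ _).trans ((Finset.sum_le_card_nsmul _ _ 2 fun p _ => ?_).trans ?_)
    · split_ifs
      · exact hG _
      · simp
    · simp [mul_comm]
  have h1 : ∑ p ∈ Q, ∑ r ∈ Finset.Icc 1 (N / p), G (p * r + (r.primeFactors.card + 1)) =
      ∑ r ∈ Finset.Icc 1 M, B (r.primeFactors.card + 1) r := by
    simp only [hB]
    rw [Finset.sum_comm]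
    refine Finset.sum_congr rfl fun p hp => ?_
    have hp0 : 0 < p := hpos.trans_le (hQ p hp)
    rw [← Finset.sum_filter]
    refine Finset.sum_congr ?_ fun _ _ => rfl
    ext r
    rw [Finset.mem_filter, Finset.mem_Icc, Finset.mem_Icc, Nat.le_div_iff_mul_le hp0, mul_comm r p]
    constructor
    · rintro ⟨h2, h3⟩
      refine ⟨⟨h2, ?_⟩, h3⟩
      rw [hM, Nat.le_div_iff_mul_le hpos, mul_comm]
      exact (Nat.mul_le_mul_right r (hQ p hp)).trans h3
    · rintro ⟨⟨h2, _⟩, h3⟩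
      exact ⟨h2, h3⟩
  have h2 : ∀ r, ‖B (r.primeFactors.card + 1) r‖ ≤ 2 * Q.card * (r.primeFactors.card / K) +
      √(∑ k ∈ Finset.Icc 1 K, ‖B k r‖ ^ 2) := by
    intro r
    by_cases h : K ≤ r.primeFactors.card
    · refine le_add_of_le_of_nonneg ((hBn _ r).trans ?_) (Real.sqrt_nonneg _)
      refine le_mul_of_one_le_right (by positivity) ?_
      rw [one_le_div hKr]; exact_mod_cast h
    · refine le_add_of_nonneg_of_le (by positivity) ?_
      apply Real.le_sqrt_of_sq_le
      exact Finset.single_le_sum (f := fun k => ‖B k r‖ ^ 2) (fun _ _ => by positivity)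
        (Finset.mem_Icc.2 ⟨by omega, by omega⟩)
  have h3 : ∑ r ∈ Finset.Icc 1 M, √(∑ k ∈ Finset.Icc 1 K, ‖B k r‖ ^ 2) ≤
      N * √(K * (4 / 2 ^ i + ε)) := by
    have h4 : (∑ r ∈ Finset.Icc 1 M, √(∑ k ∈ Finset.Icc 1 K, ‖B k r‖ ^ 2)) ^ 2 ≤
        M * (K * (N * (4 + 2 ^ i * ε))) := by
      refine (sq_sum_le_card_mul_sum_sq).trans ?_
      rw [Nat.card_Icc, Nat.add_sub_cancel]
      gcongr
      have : ∀ r, √(∑ k ∈ Finset.Icc 1 K, ‖B k r‖ ^ 2) ^ 2 = ∑ k ∈ Finset.Icc 1 K, ‖B k r‖ ^ 2 :=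
        fun r => Real.sq_sqrt (Finset.sum_nonneg fun _ _ => by positivity)
      simp only [this]
      rw [Finset.sum_comm]
      refine (Finset.sum_le_card_nsmul _ _ _ fun k hk =>
        sum_norm_sq_bilinear_le hε hQ hcard hG fun p hp p' hp' hne =>
          hcorr p hp p' hp' hne k hk).trans ?_
      simp
    have h5 : (M : ℝ) * (K * (N * (4 + 2 ^ i * ε))) ≤ (N * √(K * (4 / 2 ^ i + ε))) ^ 2 := by
      rw [mul_pow, Real.sq_sqrt (by positivity)]
      calc (M : ℝ) * (K * (N * (4 + 2 ^ i * ε))) =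
            (2 ^ i * M) * (N * (K * (4 / 2 ^ i + ε))) := by
              have h6 : 4 + 2 ^ i * ε = 2 ^ i * (4 / 2 ^ i + ε) := by
                rw [mul_add, mul_div_cancel₀ _ (by positivity)]
              rw [h6]; ring
        _ ≤ N * (N * (K * (4 / 2 ^ i + ε))) := by gcongr
        _ = _ := by ring
    exact (abs_le_of_sq_le_sq' (h4.trans h5) (by positivity)).2
  rw [h1]
  refine (norm_sum_le _ _).trans ((Finset.sum_le_sum fun r _ => h2 r).trans ?_)
  rw [Finset.sum_add_distrib, mul_add]
  refine add_le_add ?_ h3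
  rw [← Finset.mul_sum, ← Finset.sum_div]
  have h6 : ∑ r ∈ Finset.Icc 1 M, (r.primeFactors.card : ℝ) ≤ M * H :=
    sum_card_primeFactors_le (Nat.div_le_self N (2 ^ i)) hH
  have h7 : 0 ≤ ∑ r ∈ Finset.Icc 1 M, (r.primeFactors.card : ℝ) :=
    Finset.sum_nonneg fun _ _ => Nat.cast_nonneg _
  calc 2 * (Q.card : ℝ) * ((∑ r ∈ Finset.Icc 1 M, (r.primeFactors.card : ℝ)) / K)
      ≤ 2 * 2 ^ i * (M * H / K) :=
        mul_le_mul (mul_le_mul_of_nonneg_left hcard' zero_le_two)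
          (div_le_div_of_nonneg_right h6 hKr.le) (div_nonneg h7 hKr.le) (by positivity)
    _ = (2 ^ i * M) * (2 * H / K) := by ring
    _ ≤ N * (2 * H / K) :=
        mul_le_mul_of_nonneg_right hMN (div_nonneg (mul_nonneg zero_le_two hH0) hKr.le)

theorem norm_sum_prime_mul_sub_le {p : ℕ} (hp : p.Prime) (N : ℕ) {G : ℕ → ℂ}
    (hG : ∀ n, ‖G n‖ ≤ 2) :
    ‖∑ r ∈ Finset.Icc 1 (N / p), G (p * r + (p * r).primeFactors.card) -
      ∑ r ∈ Finset.Icc 1 (N / p), G (p * r + (r.primeFactors.card + 1))‖ ≤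
      4 * N * (1 / p) * (1 / p) := by
  rw [← Finset.sum_sub_distrib]
  calc _ ≤ ∑ r ∈ Finset.Icc 1 (N / p), if p ∣ r then (4 : ℝ) else 0 := by
        refine norm_sum_le_of_le _ fun r hr => ?_
        split_ifs with h
        · refine (norm_sub_le _ _).trans ?_
          linarith [hG (p * r + (p * r).primeFactors.card), hG (p * r + (r.primeFactors.card + 1))]
        · rw [card_primeFactors_prime_mul hp (by have := (Finset.mem_Icc.1 hr).1; omega) h]
          simp
    _ = 4 * (N / p / p : ℕ) := by
        rw [← Finset.sum_filter, Finset.sum_const, card_filter_dvd_Icc, nsmul_eq_mul, mul_comm]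
    _ ≤ 4 * (N * (1 / p) * (1 / p)) := by
        gcongr
        refine (natCast_div_le_mul_one_div _ _).trans ?_
        gcongr
        exact natCast_div_le_mul_one_div _ _
    _ = _ := by ring

/-- The primes in `[2 ^ a, 2 ^ b)`. -/
def dyadicPrimes (a b : ℕ) : Finset ℕ := (Finset.Ico (2 ^ a) (2 ^ b)).filter Nat.Prime

theorem prime_of_mem_dyadicPrimes {a b p : ℕ} (hp : p ∈ dyadicPrimes a b) : p.Prime :=
  (Finset.mem_filter.1 hp).2

theorem norm_sum_dyadicPrimes_le {a b N K : ℕ} {G : ℕ → ℂ} {ε H : ℝ} (hε : 0 ≤ ε)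
    (hK : 0 < K) (hG : ∀ n, ‖G n‖ ≤ 2)
    (hcorr : ∀ p ∈ dyadicPrimes a b, ∀ p' ∈ dyadicPrimes a b, p ≠ p' → ∀ k ∈ Finset.Icc 1 K,
      ‖∑ r ∈ Finset.Icc 1 (N / max p p'), G (p * r + k) * (starRingEnd ℂ) (G (p' * r + k))‖ ≤
        ε * (N / max p p' : ℕ))
    (hH : ∑ p ∈ (Finset.range (N + 1)).filter Nat.Prime, 1 / (p : ℝ) ≤ H) :
    ‖∑ p ∈ dyadicPrimes a b, ∑ r ∈ Finset.Icc 1 (N / p), G (p * r + (r.primeFactors.card + 1))‖ ≤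
      b * (N * (2 * H / K + √(K * (4 / 2 ^ a + ε)))) := by
  have hlog : ∀ p ∈ dyadicPrimes a b, Nat.log 2 p ∈ Finset.Ico a b := by
    intro p hp
    have hp' := Finset.mem_Ico.1 (Finset.mem_filter.1 hp).1
    have hp0 : p ≠ 0 := (Finset.mem_filter.1 hp).2.ne_zero
    exact Finset.mem_Ico.2 ⟨Nat.le_log_of_pow_le (by norm_num) hp'.1,
      (Nat.log_lt_iff_lt_pow (by norm_num) hp0).2 hp'.2⟩
  have hH0 : 0 ≤ H := le_trans (Finset.sum_nonneg fun _ _ => by positivity) hH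
  rw [← Finset.sum_fiberwise_of_maps_to hlog]
  refine (norm_sum_le _ _).trans ?_
  refine (Finset.sum_le_card_nsmul _ _ (N * (2 * H / K + √(K * (4 / 2 ^ a + ε)))) ?_).trans ?_
  · intro i hi
    have hai := (Finset.mem_Ico.1 hi).1
    refine (norm_sum_block_le (i := i) (K := K) hε hK ?_ ?_ hG ?_ hH).trans ?_
    · intro p hp
      obtain ⟨hp', rfl⟩ := Finset.mem_filter.1 hp
      exact Nat.pow_log_le_self 2 (prime_of_mem_dyadicPrimes hp').ne_zero
    · have : (dyadicPrimes a b).filter (fun p => Nat.log 2 p = i) ⊆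
          Finset.Ico (2 ^ i) (2 ^ (i + 1)) := by
        intro p hp
        obtain ⟨hp', rfl⟩ := Finset.mem_filter.1 hp
        exact Finset.mem_Ico.2 ⟨Nat.pow_log_le_self 2 (prime_of_mem_dyadicPrimes hp').ne_zero,
          Nat.lt_pow_succ_log_self (by norm_num) p⟩
      refine (Finset.card_le_card this).trans_eq ?_
      rw [Nat.card_Ico, pow_succ]; omega
    · intro p hp p' hp'
      exact hcorr p (Finset.mem_filter.1 hp).1 p' (Finset.mem_filter.1 hp').1
    · gcongr
      norm_num
  · rw [Nat.card_Ico, nsmul_eq_mul]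
    gcongr
    omega

theorem norm_sum_add_omega_le {a b N K : ℕ} {G : ℕ → ℂ} {ε H : ℝ} (hε : 0 ≤ ε)
    (hK : 0 < K) (hG : ∀ n, ‖G n‖ ≤ 2)
    (hcorr : ∀ p ∈ dyadicPrimes a b, ∀ p' ∈ dyadicPrimes a b, p ≠ p' → ∀ k ∈ Finset.Icc 1 K,
      ‖∑ r ∈ Finset.Icc 1 (N / max p p'), G (p * r + k) * (starRingEnd ℂ) (G (p' * r + k))‖ ≤
        ε * (N / max p p' : ℕ))
    (hH : ∑ p ∈ (Finset.range (N + 1)).filter Nat.Prime, 1 / (p : ℝ) ≤ H)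
    (hN : 2 ^ b ≤ N) :
    (∑ p ∈ dyadicPrimes a b, 1 / (p : ℝ)) *
        ‖∑ n ∈ Finset.Icc 1 N, G (n + n.primeFactors.card)‖ ≤
      N * (4 * √(∑ p ∈ dyadicPrimes a b, 1 / (p : ℝ)) +
        4 * (∑ p ∈ dyadicPrimes a b, 1 / (p : ℝ)) / 2 ^ a +
        b * (2 * H / K + √(K * (4 / 2 ^ a + ε)))) := by
  set Q := dyadicPrimes a b with hQ
  have hprime : ∀ p ∈ Q, p.Prime := fun p hp => (Finset.mem_filter.1 hp).2
  set S := ∑ p ∈ Q, 1 / (p : ℝ) with hS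
  have hS0 : 0 ≤ S := Finset.sum_nonneg fun _ _ => by positivity
  set F : ℕ → ℂ := fun n => G (n + n.primeFactors.card) with hF
  have hcard : Q.card ≤ N := by
    refine (Finset.card_filter_le _ _).trans ?_
    rw [Nat.card_Ico]; exact (Nat.sub_le _ _).trans hN
  have h1 : ‖∑ n ∈ Finset.Icc 1 N, F n * ((S : ℂ) - ((Q.filter (· ∣ n)).card : ℂ))‖ ≤
      N * (4 * √S) := by
    calc _ ≤ ∑ n ∈ Finset.Icc 1 N, 2 * |((Q.filter (· ∣ n)).card : ℝ) - S| := by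
          refine norm_sum_le_of_le _ fun n _ => ?_
          rw [norm_mul]
          have : ‖(S : ℂ) - ((Q.filter (· ∣ n)).card : ℂ)‖ =
              |((Q.filter (· ∣ n)).card : ℝ) - S| := by
            rw [← Complex.ofReal_natCast, ← Complex.ofReal_sub, Complex.norm_real,
              Real.norm_eq_abs, abs_sub_comm]
          rw [this]
          gcongr
          exact hG _
      _ = 2 * ∑ n ∈ Finset.Icc 1 N, |((Q.filter (· ∣ n)).card : ℝ) - S| := by rw [Finset.mul_sum]
      _ ≤ 2 * (N * (2 * √S)) := by
          gcongr
          refine (abs_le_of_sq_le_sq' ?_ (by positivity)).2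
          refine sq_sum_le_card_mul_sum_sq.trans ?_
          simp only [sq_abs]
          rw [Nat.card_Icc, Nat.add_sub_cancel, mul_pow, mul_pow, Real.sq_sqrt hS0]
          have h2 := turan_kubilius hprime N
          have h3 : (Q.card : ℝ) ≤ N := by exact_mod_cast hcard
          calc (N : ℝ) * _ ≤ N * (S * (N + 2 * Q.card)) := by gcongr
            _ ≤ N * (S * (N + 2 * N)) := by gcongr
            _ ≤ _ := by nlinarith [mul_nonneg hS0 (sq_nonneg (N : ℝ))]
      _ = _ := by ring
  have h4 : ‖∑ n ∈ Finset.Icc 1 N, F n * ((Q.filter (· ∣ n)).card : ℂ)‖ ≤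
      N * (4 * S / 2 ^ a) + b * (N * (2 * H / K + √(K * (4 / 2 ^ a + ε)))) := by
    rw [sum_mul_card_filter_dvd Q (fun p hp => (hprime p hp).pos) N F]
    have h5 := norm_sum_dyadicPrimes_le hε hK hG hcorr hH
    have h6 : ‖∑ p ∈ Q, ∑ r ∈ Finset.Icc 1 (N / p), F (p * r) -
        ∑ p ∈ Q, ∑ r ∈ Finset.Icc 1 (N / p), G (p * r + (r.primeFactors.card + 1))‖ ≤
        N * (4 * S / 2 ^ a) := by
      rw [← Finset.sum_sub_distrib]
      calc _ ≤ ∑ p ∈ Q, 4 * N * (1 / p) * (1 / 2 ^ a : ℝ) := by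
            refine norm_sum_le_of_le _ fun p hp => ?_
            refine (norm_sum_prime_mul_sub_le (hprime p hp) N hG).trans ?_
            gcongr
            exact_mod_cast (Finset.mem_Ico.1 (Finset.mem_filter.1 hp).1).1
        _ = _ := by rw [← Finset.sum_mul, ← Finset.mul_sum, ← hS]; ring
    have := norm_le_norm_sub_add (∑ p ∈ Q, ∑ r ∈ Finset.Icc 1 (N / p), F (p * r))
      (∑ p ∈ Q, ∑ r ∈ Finset.Icc 1 (N / p), G (p * r + (r.primeFactors.card + 1)))
    linarith
  have h7 : (S : ℂ) * ∑ n ∈ Finset.Icc 1 N, F n =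
      ∑ n ∈ Finset.Icc 1 N, F n * ((S : ℂ) - ((Q.filter (· ∣ n)).card : ℂ)) +
      ∑ n ∈ Finset.Icc 1 N, F n * ((Q.filter (· ∣ n)).card : ℂ) := by
    rw [← Finset.sum_add_distrib, Finset.mul_sum]
    exact Finset.sum_congr rfl fun n _ => by ring
  have h8 : S * ‖∑ n ∈ Finset.Icc 1 N, F n‖ = ‖(S : ℂ) * ∑ n ∈ Finset.Icc 1 N, F n‖ := by
    rw [norm_mul, Complex.norm_real, Real.norm_of_nonneg hS0]
  rw [h8, h7]
  refine (norm_add_le _ _).trans ((add_le_add h1 h4).trans_eq ?_)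
  ring

/-- The sum of `log p / p` over the primes up to `n`. -/
def primeLogSum (n : ℕ) : ℝ := ∑ k ∈ Finset.Icc 0 n, if k.Prime then Real.log k / k else 0

theorem log_factorial_eq_sum (n : ℕ) : Real.log (n.factorial : ℝ) =
    ∑ p ∈ (Finset.Icc 0 n).filter Nat.Prime, (padicValNat p n.factorial : ℝ) * Real.log p := by
  rw [Real.log_nat_eq_sum_factorization, Finsupp.sum]
  have hsub : n.factorial.factorization.support ⊆ (Finset.Icc 0 n).filter Nat.Prime := by
    intro p hp
    rw [Nat.support_factorization, Nat.mem_primeFactors] at hp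
    exact Finset.mem_filter.2 ⟨Finset.mem_Icc.2 ⟨Nat.zero_le _, (hp.1.dvd_factorial).1 hp.2.1⟩, hp.1⟩
  rw [Finset.sum_subset hsub]
  · refine Finset.sum_congr rfl fun p hp => ?_
    rw [Nat.factorization_def _ (Finset.mem_filter.1 hp).2]
  · intro p _ hp
    rw [Finsupp.notMem_support_iff] at hp
    simp [hp]

theorem log_factorial_le (n : ℕ) : Real.log (n.factorial : ℝ) ≤ n * Real.log n := by
  rw [← Real.log_pow]
  exact Real.log_le_log (by exact_mod_cast n.factorial_pos) (by exact_mod_cast n.factorial_le_pow)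

theorem primeLogSum_le {n : ℕ} (hn : 0 < n) : primeLogSum n ≤ Real.log n + Real.log 4 := by
  have hn' : (0 : ℝ) < n := by exact_mod_cast hn
  have h1 : n * primeLogSum n - Chebyshev.theta n ≤ Real.log (n.factorial : ℝ) := by
    rw [log_factorial_eq_sum, primeLogSum, Chebyshev.theta_eq_sum_Icc, Nat.floor_natCast,
      ← Finset.sum_filter, Finset.mul_sum, ← Finset.sum_sub_distrib]
    refine Finset.sum_le_sum fun p hp => ?_
    have hp' := (Finset.mem_filter.1 hp).2
    have := Fact.mk hp'
    have hlog : 0 ≤ Real.log p := Real.log_natCast_nonneg p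
    have h2 : n / p ≤ padicValNat p n.factorial := by
      rw [padicValNat_factorial (b := Nat.log p n + 2) (by omega)]
      have := Finset.single_le_sum (f := fun i => n / p ^ i) (s := Finset.Ico 1 (Nat.log p n + 2))
        (fun _ _ => Nat.zero_le _) (a := 1) (Finset.mem_Ico.2 ⟨le_rfl, by omega⟩)
      simpa using this
    have h3 : (n : ℝ) / p - 1 ≤ padicValNat p n.factorial := by
      have h4 := Nat.lt_floor_add_one ((n : ℝ) / p)
      rw [Nat.floor_div_eq_div] at h4
      have h5 : ((n / p : ℕ) : ℝ) ≤ padicValNat p n.factorial := by exact_mod_cast h2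
      linarith
    calc (n : ℝ) * (Real.log p / p) - Real.log p = (n / p - 1) * Real.log p := by ring
      _ ≤ _ := by gcongr
  have h2 := Chebyshev.theta_le_log4_mul_x hn'.le
  have h3 := log_factorial_le n
  have h4 : n * primeLogSum n ≤ n * (Real.log n + Real.log 4) := by linarith
  exact le_of_mul_le_mul_left h4 hn'

theorem exists_le_primeLogSum : ∃ C : ℝ, ∀ n : ℕ, 0 < n → Real.log n - C ≤ primeLogSum n := by
  have hsum : Summable fun k : ℕ => 4 * (k : ℝ) ^ (-(3 / 2) : ℝ) :=
    (Real.summable_nat_rpow.2 (by norm_num)).mul_left 4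
  refine ⟨1 + ∑' k : ℕ, 4 * (k : ℝ) ^ (-(3 / 2) : ℝ), fun n hn => ?_⟩
  have hn' : (0 : ℝ) < n := by exact_mod_cast hn
  have h1 : Real.log (n.factorial : ℝ) ≤ n * (primeLogSum n +
      ∑ k ∈ (Finset.Icc 0 n).filter Nat.Prime, 4 * (k : ℝ) ^ (-(3 / 2) : ℝ)) := by
    rw [log_factorial_eq_sum, primeLogSum, ← Finset.sum_filter, ← Finset.sum_add_distrib,
      Finset.mul_sum]
    refine Finset.sum_le_sum fun p hp => ?_
    have hp' := (Finset.mem_filter.1 hp).2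
    have := Fact.mk hp'
    have hlog : 0 ≤ Real.log p := Real.log_natCast_nonneg p
    have hp2 : (2 : ℝ) ≤ p := by exact_mod_cast hp'.two_le
    have hp0 : (0 : ℝ) < p := by linarith
    have h2 : (padicValNat p n.factorial : ℝ) ≤ n / (p - 1) := by
      rw [le_div_iff₀ (by linarith), mul_comm]
      have h3 : (p - 1) * padicValNat p n.factorial ≤ n := by
        rw [sub_one_mul_padicValNat_factorial]; exact Nat.sub_le _ _
      have h4 : (((p - 1 : ℕ) : ℝ)) * padicValNat p n.factorial ≤ n := by exact_mod_cast h3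
      rwa [Nat.cast_sub hp'.one_le, Nat.cast_one] at h4
    have h5 : Real.log p ≤ 2 * (p : ℝ) ^ (1 / 2 : ℝ) := by
      have := Real.log_le_rpow_div hp0.le (ε := 1 / 2) (by norm_num)
      linarith
    have h6 : (p : ℝ) ^ (-(3 / 2) : ℝ) = (p : ℝ) ^ (1 / 2 : ℝ) / p ^ 2 := by
      rw [← Real.rpow_natCast, ← Real.rpow_sub hp0]; norm_num
    have h7 : 1 / ((p : ℝ) - 1) ≤ 1 / p + 2 / p ^ 2 := by
      rw [div_add_div _ _ (by positivity) (by positivity), div_le_div_iff₀ (by linarith)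
        (by positivity)]
      nlinarith [mul_nonneg hp0.le (by linarith : (0 : ℝ) ≤ p - 2)]
    calc (padicValNat p n.factorial : ℝ) * Real.log p ≤ n / (p - 1) * Real.log p := by gcongr
      _ = n * ((1 / (p - 1)) * Real.log p) := by ring
      _ ≤ n * ((1 / p + 2 / p ^ 2) * Real.log p) := by gcongr
      _ = n * (Real.log p / p + 2 / p ^ 2 * Real.log p) := by ring
      _ ≤ n * (Real.log p / p + 2 / p ^ 2 * (2 * (p : ℝ) ^ (1 / 2 : ℝ))) := by gcongr
      _ = _ := by rw [h6]; ring
  have h2 := Stirling.le_log_factorial_stirling hn.ne'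
  have h3 : 0 ≤ Real.log n := Real.log_natCast_nonneg n
  have h4 : 0 ≤ Real.log (2 * Real.pi) := Real.log_nonneg (by linarith [Real.pi_gt_three])
  have h5 : ∑ k ∈ (Finset.Icc 0 n).filter Nat.Prime, 4 * (k : ℝ) ^ (-(3 / 2) : ℝ) ≤
      ∑' k : ℕ, 4 * (k : ℝ) ^ (-(3 / 2) : ℝ) :=
    hsum.sum_le_tsum _ fun _ _ => by positivity
  have h6 : n * (Real.log n - 1) ≤ n * (primeLogSum n +
      ∑ k ∈ (Finset.Icc 0 n).filter Nat.Prime, 4 * (k : ℝ) ^ (-(3 / 2) : ℝ)) := by linarith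
  have h7 := le_of_mul_le_mul_left h6 hn'
  linarith

/-- **Mertens' first theorem.** -/
theorem exists_abs_primeLogSum_sub_log_le : ∃ C : ℝ, ∀ t : ℝ, 2 ≤ t →
    |primeLogSum ⌊t⌋₊ - Real.log t| ≤ C := by
  obtain ⟨C, hC⟩ := exists_le_primeLogSum
  refine ⟨max (Real.log 4) (C + Real.log 2), fun t ht => ?_⟩
  have hfl : 1 ≤ ⌊t⌋₊ := Nat.le_floor (by norm_num; linarith)
  have hfl' : (1 : ℝ) ≤ ⌊t⌋₊ := by exact_mod_cast hfl
  have h1 := primeLogSum_le hfl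
  have h2 := hC _ hfl
  have h3 : Real.log ⌊t⌋₊ ≤ Real.log t :=
    Real.log_le_log (by linarith) (Nat.floor_le (by linarith))
  have h4 : Real.log t ≤ Real.log ⌊t⌋₊ + Real.log 2 := by
    rw [← Real.log_mul (by positivity) (by norm_num)]
    refine Real.log_le_log (by linarith) ?_
    linarith [Nat.lt_floor_add_one t]
  have h5 := le_max_left (Real.log 4) (C + Real.log 2)
  have h6 := le_max_right (Real.log 4) (C + Real.log 2)
  rw [abs_le]; constructor <;> linarith

theorem hasDerivAt_loglog_sub_div_log (C : ℝ) {t : ℝ} (ht : 2 ≤ t) :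
    HasDerivAt (fun t => Real.log (Real.log t) - C * (Real.log t)⁻¹)
      (t⁻¹ / (Real.log t) ^ 2 * (Real.log t + C)) t := by
  have ht0 : t ≠ 0 := by linarith
  have hl : 0 < Real.log t := Real.log_pos (by linarith)
  have h1 := Real.hasDerivAt_log ht0
  have h2 := (h1.log hl.ne').sub ((h1.inv hl.ne').const_mul C)
  convert! h2 using 1
  field_simp
  ring

theorem integral_log_add_const_eq (C : ℝ) {x : ℝ} (hx : 2 ≤ x) :
    IntervalIntegrable (fun t => t⁻¹ / (Real.log t) ^ 2 * (Real.log t + C))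
      MeasureTheory.volume 2 x ∧
    ∫ t in (2 : ℝ)..x, t⁻¹ / (Real.log t) ^ 2 * (Real.log t + C) =
      (Real.log (Real.log x) - C * (Real.log x)⁻¹) -
        (Real.log (Real.log 2) - C * (Real.log 2)⁻¹) := by
  have hii : IntervalIntegrable (fun t => t⁻¹ / (Real.log t) ^ 2 * (Real.log t + C))
      MeasureTheory.volume 2 x := by
    refine ContinuousOn.intervalIntegrable fun t ht => ?_
    rw [Set.uIcc_of_le hx] at ht
    have ht0 : t ≠ 0 := by linarith [ht.1]
    have hl : 0 < Real.log t := Real.log_pos (by linarith [ht.1])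
    have hc : ContinuousAt Real.log t := Real.continuousAt_log ht0
    exact (((continuousAt_inv₀ ht0).div (hc.pow 2) (pow_ne_zero 2 hl.ne')).mul
      (hc.add continuousAt_const)).continuousWithinAt
  refine ⟨hii, intervalIntegral.integral_eq_sub_of_hasDerivAt
    (f := fun t => Real.log (Real.log t) - C * (Real.log t)⁻¹) (fun t ht => ?_) hii⟩
  rw [Set.uIcc_of_le hx] at ht
  exact hasDerivAt_loglog_sub_div_log C ht.1

/-- **Mertens' second theorem**, up to a bounded error. -/
theorem exists_abs_sum_prime_one_div_sub_loglog_le : ∃ C : ℝ, 0 ≤ C ∧ ∀ x : ℝ, 2 ≤ x →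
    |∑ p ∈ (Finset.range (⌊x⌋₊ + 1)).filter Nat.Prime, 1 / (p : ℝ) - Real.log (Real.log x)| ≤
      C := by
  obtain ⟨C, hC⟩ := exists_abs_primeLogSum_sub_log_le
  have hC0 : 0 ≤ C := (abs_nonneg _).trans (hC 2 le_rfl)
  have hl2 : 0 < Real.log 2 := Real.log_pos (by norm_num)
  refine ⟨1 + |Real.log (Real.log 2)| + 2 * (C / Real.log 2), by positivity, fun x hx => ?_⟩
  have hlx : 0 < Real.log x := Real.log_pos (by linarith)
  have hl2x : Real.log 2 ≤ Real.log x := Real.log_le_log (by norm_num) hx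
  set c : ℕ → ℝ := fun k => if k.Prime then Real.log k / k else 0 with hc
  have hderiv : ∀ t : ℝ, 2 ≤ t → HasDerivAt (fun t => (Real.log t)⁻¹)
      (-(t⁻¹ / (Real.log t) ^ 2)) t := by
    intro t ht
    have hl : 0 < Real.log t := Real.log_pos (by linarith)
    have := (Real.hasDerivAt_log (by linarith : t ≠ 0)).inv hl.ne'
    convert! this using 1
    ring
  have hcont : ContinuousOn (fun t : ℝ => -(t⁻¹ / (Real.log t) ^ 2)) (Set.Icc 2 x) := by
    intro t ht
    have ht0 : t ≠ 0 := by linarith [ht.1]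
    have hl : 0 < Real.log t := Real.log_pos (by linarith [ht.1])
    exact ((continuousAt_inv₀ ht0).div ((Real.continuousAt_log ht0).pow 2)
      (pow_ne_zero 2 hl.ne')).neg.continuousWithinAt
  have hdint : MeasureTheory.IntegrableOn (deriv fun t => (Real.log t)⁻¹) (Set.Icc 2 x) :=
    (hcont.integrableOn_Icc).congr_fun (fun t ht => ((hderiv t ht.1).deriv).symm) measurableSet_Icc
  have habel := sum_mul_eq_sub_integral_mul₁ c (f := fun t => (Real.log t)⁻¹) (by simp [hc])
    (by simp [hc]) x (fun t ht => (hderiv t ht.1).differentiableAt) hdint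
  have hlhs : ∑ k ∈ Finset.Icc 0 ⌊x⌋₊, (Real.log k)⁻¹ * c k =
      ∑ p ∈ (Finset.range (⌊x⌋₊ + 1)).filter Nat.Prime, 1 / (p : ℝ) := by
    have : Finset.Icc 0 ⌊x⌋₊ = Finset.range (⌊x⌋₊ + 1) := by
      ext; simp
    rw [this, Finset.sum_filter]
    refine Finset.sum_congr rfl fun k _ => ?_
    simp only [hc]
    split_ifs with hk
    · have : 0 < Real.log k := Real.log_pos (by exact_mod_cast hk.one_lt)
      field_simp
    · simp
  have hA : ∀ t : ℝ, ∑ k ∈ Finset.Icc 0 ⌊t⌋₊, c k = primeLogSum ⌊t⌋₊ := fun t => rfl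
  simp only [hA] at habel
  rw [hlhs] at habel
  have hI : ∫ t in Set.Ioc 2 x, deriv (fun t => (Real.log t)⁻¹) t * primeLogSum ⌊t⌋₊ =
      -∫ t in (2 : ℝ)..x, t⁻¹ / (Real.log t) ^ 2 * primeLogSum ⌊t⌋₊ := by
    rw [intervalIntegral.integral_of_le hx, ← MeasureTheory.integral_neg]
    refine MeasureTheory.setIntegral_congr_fun measurableSet_Ioc fun t ht => ?_
    rw [(hderiv t ht.1.le).deriv]; ring
  rw [hI, sub_neg_eq_add] at habel
  have hii : IntervalIntegrable (fun t => t⁻¹ / (Real.log t) ^ 2 * primeLogSum ⌊t⌋₊)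
      MeasureTheory.volume 2 x := by
    rw [intervalIntegrable_iff_integrableOn_Icc_of_le hx]
    have := integrableOn_mul_sum_Icc (m := 0) (a := 2) c (by norm_num) (hcont.integrableOn_Icc)
    refine this.neg.congr_fun (fun t _ => ?_) measurableSet_Icc
    simp only [Pi.neg_apply, hA]; ring
  have hw : ∀ t ∈ Set.Icc 2 x, 0 ≤ t⁻¹ / (Real.log t) ^ 2 := fun t ht => by
    have : 0 ≤ t := by linarith [ht.1]
    positivity
  obtain ⟨i1, e1⟩ := integral_log_add_const_eq C hx
  obtain ⟨i2, e2⟩ := integral_log_add_const_eq (-C) hx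
  have hup : ∫ t in (2 : ℝ)..x, t⁻¹ / (Real.log t) ^ 2 * primeLogSum ⌊t⌋₊ ≤ _ :=
    intervalIntegral.integral_mono_on hx hii i1 fun t ht =>
      mul_le_mul_of_nonneg_left (by have := (abs_le.1 (hC t ht.1)).2; linarith) (hw t ht)
  have hlo : _ ≤ ∫ t in (2 : ℝ)..x, t⁻¹ / (Real.log t) ^ 2 * primeLogSum ⌊t⌋₊ :=
    intervalIntegral.integral_mono_on hx i2 hii fun t ht =>
      mul_le_mul_of_nonneg_left (by have := (abs_le.1 (hC t ht.1)).1; linarith) (hw t ht)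
  rw [e1] at hup
  rw [e2] at hlo
  have hx1 := abs_le.1 (hC x hx)
  have hmain : |(Real.log x)⁻¹ * primeLogSum ⌊x⌋₊ - 1| ≤ C * (Real.log x)⁻¹ := by
    have : (Real.log x)⁻¹ * primeLogSum ⌊x⌋₊ - 1 =
        (primeLogSum ⌊x⌋₊ - Real.log x) * (Real.log x)⁻¹ := by field_simp
    rw [this, abs_mul, abs_of_pos (inv_pos.2 hlx)]
    gcongr
    exact hC x hx
  have hm := abs_le.1 hmain
  have hinv : C * (Real.log x)⁻¹ ≤ C / Real.log 2 := by
    rw [div_eq_mul_inv]; gcongr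
  have hinv0 : 0 ≤ C * (Real.log x)⁻¹ := by positivity
  have hdiv : C * (Real.log 2)⁻¹ = C / Real.log 2 := by rw [div_eq_mul_inv]
  have hab := abs_le.1 (le_refl |Real.log (Real.log 2)|)
  have hd0 : 0 ≤ C / Real.log 2 := by positivity
  rw [habel, abs_le]
  constructor <;> nlinarith

theorem norm_bernoulliFactor_sub_exp_le {q : ℕ} (hq : 0 < q) {τ : ℝ} (hτ : |τ| ≤ 1) :
    ‖bernoulliFactor q τ - Complex.exp ((-(τ ^ 2 / (2 * q)) : ℝ) : ℂ)‖ ≤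
      5 * τ ^ 2 * (1 / q ^ 2) + 2 * |τ| ^ 3 * (1 / q) := by
  have hq1 : (1 : ℝ) ≤ q := by exact_mod_cast hq
  have hq0 : (0 : ℝ) < q := by linarith
  have hqc : (q : ℂ) ≠ 0 := by exact_mod_cast hq.ne'
  set A := Complex.exp (Complex.I * ((-τ / q : ℝ) : ℂ)) with hA
  set w := Complex.exp (Complex.I * (τ : ℂ)) - 1 with hw
  set u : ℝ := τ / q with hu
  have hu1 : |u| ≤ 1 := by
    rw [hu, abs_div, abs_of_pos hq0, div_le_one hq0]; linarith
  have hAerr : ‖A - (1 - Complex.I * (u : ℂ))‖ ≤ u ^ 2 := by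
    have := norm_exp_I_mul_sub_taylor_le 2 (-τ / q)
    simp only [Finset.sum_range_succ, Finset.sum_range_zero, pow_zero, pow_one, Nat.factorial,
      zero_add, Nat.cast_one, div_one, mul_one] at this
    have h2 : A - (1 - Complex.I * (u : ℂ)) = A - (1 + Complex.I * ((-τ / q : ℝ) : ℂ)) := by
      rw [hu]; push_cast; ring
    rw [h2]
    refine this.trans ?_
    rw [sq_abs, neg_div, neg_sq]
    have : 0 ≤ (τ / q) ^ 2 := sq_nonneg _
    rw [hu]
    norm_num
    linarith
  have hwerr : ‖w - (Complex.I * (τ : ℂ) - (τ ^ 2 / 2 : ℝ))‖ ≤ |τ| ^ 3 := by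
    have := norm_exp_I_mul_sub_taylor_le 3 τ
    simp only [Finset.sum_range_succ, Finset.sum_range_zero, pow_zero, pow_one, Nat.factorial,
      zero_add, Nat.cast_one, div_one, mul_one] at this
    have h2 : w - (Complex.I * (τ : ℂ) - (τ ^ 2 / 2 : ℝ)) = Complex.exp (Complex.I * (τ : ℂ)) -
        (1 + Complex.I * (τ : ℂ) + (Complex.I * (τ : ℂ)) ^ 2 / ((2 : ℕ) : ℂ)) := by
      rw [mul_pow, Complex.I_sq, hw]; push_cast; ring
    rw [h2]
    refine le_trans ?_ (this.trans ?_)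
    · norm_num
    · have : 0 ≤ |τ| ^ 3 := by positivity
      norm_num
      linarith
  have hwn : ‖w‖ ≤ |τ| := norm_exp_I_mul_sub_one_le τ
  set r := w - (Complex.I * (τ : ℂ) - (τ ^ 2 / 2 : ℝ)) with hr
  have hB : ‖1 + w / q‖ ≤ 2 := by
    refine (norm_add_le _ _).trans ?_
    rw [norm_one, norm_div, Complex.norm_natCast]
    have : ‖w‖ / q ≤ 1 := by rw [div_le_one hq0]; linarith
    linarith
  have hI : ‖1 - Complex.I * (u : ℂ)‖ ≤ 2 := by
    refine (norm_sub_le _ _).trans ?_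
    rw [norm_one, norm_mul, Complex.norm_I, Complex.norm_real, Real.norm_eq_abs]
    linarith
  have hexp : ‖((1 - τ ^ 2 / (2 * q) : ℝ) : ℂ) - Complex.exp ((-(τ ^ 2 / (2 * q)) : ℝ) : ℂ)‖ ≤
      u ^ 2 := by
    rw [← Complex.ofReal_exp, ← Complex.ofReal_sub, Complex.norm_real, Real.norm_eq_abs,
      abs_sub_comm]
    have ht2 : τ ^ 2 ≤ 1 := (sq_le_one_iff_abs_le_one τ).2 hτ
    have h1 : |-(τ ^ 2 / (2 * q))| ≤ 1 := by
      rw [abs_neg, abs_of_nonneg (by positivity), div_le_one (by positivity)]; linarith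
    have h2 := Real.abs_exp_sub_one_sub_id_le h1
    have h3 : Real.exp (-(τ ^ 2 / (2 * q))) - (1 - τ ^ 2 / (2 * q)) =
        Real.exp (-(τ ^ 2 / (2 * q))) - 1 - -(τ ^ 2 / (2 * q)) := by ring
    rw [h3]
    refine h2.trans ?_
    have h4 : (-(τ ^ 2 / (2 * q))) ^ 2 = τ ^ 2 / 4 * u ^ 2 := by rw [hu]; field_simp; norm_num
    rw [h4]
    exact mul_le_of_le_one_left (sq_nonneg _) (by linarith)
  have hsplit : bernoulliFactor q τ - Complex.exp ((-(τ ^ 2 / (2 * q)) : ℝ) : ℂ) =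
      (A - (1 - Complex.I * (u : ℂ))) * (1 + w / q) + (1 - Complex.I * (u : ℂ)) * (r / q) +
      ((u ^ 2 : ℝ) + Complex.I * ((τ / 2 * u ^ 2 : ℝ) : ℂ)) +
      (((1 - τ ^ 2 / (2 * q) : ℝ) : ℂ) - Complex.exp ((-(τ ^ 2 / (2 * q)) : ℝ) : ℂ)) := by
    have hb : bernoulliFactor q τ = A * (1 + w / q) := rfl
    have hwr : w = r + (Complex.I * (τ : ℂ) - (τ ^ 2 / 2 : ℝ)) := by rw [hr]; ring
    have hI2 : (Complex.I : ℂ) ^ 2 = -1 := Complex.I_sq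
    rw [hb, hwr, hu]
    push_cast
    field_simp
    ring_nf
    rw [hI2]
    ring
  have h3 : ‖((u ^ 2 : ℝ) : ℂ) + Complex.I * ((τ / 2 * u ^ 2 : ℝ) : ℂ)‖ ≤ 2 * u ^ 2 := by
    refine (norm_add_le _ _).trans ?_
    rw [norm_mul, Complex.norm_I, Complex.norm_real, Complex.norm_real, Real.norm_eq_abs,
      Real.norm_eq_abs, abs_of_nonneg (sq_nonneg u), abs_mul, abs_of_nonneg (sq_nonneg u), abs_div,
      abs_two, one_mul]
    nlinarith [sq_nonneg u]
  have h1 : ‖(A - (1 - Complex.I * (u : ℂ))) * (1 + w / q)‖ ≤ u ^ 2 * 2 := by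
    rw [norm_mul]; gcongr
  have h2 : ‖(1 - Complex.I * (u : ℂ)) * (r / q)‖ ≤ 2 * (|τ| ^ 3 / q) := by
    rw [norm_mul, norm_div, Complex.norm_natCast]; gcongr
  rw [hsplit]
  refine (norm_add₄_le).trans ?_
  have hu2 : τ ^ 2 * (1 / (q : ℝ) ^ 2) = u ^ 2 := by rw [hu]; field_simp
  have : 5 * τ ^ 2 * (1 / (q : ℝ) ^ 2) + 2 * |τ| ^ 3 * (1 / q) =
      5 * u ^ 2 + 2 * (|τ| ^ 3 / q) := by rw [← hu2]; ring
  rw [this]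
  linarith

theorem norm_modelPhase_sub_exp_le {P : Finset ℕ} {z Y : ℕ} (hz : 0 < z)
    (hP : P ⊆ Finset.Ioc z Y) {τ : ℝ} (hτ : |τ| ≤ 1) :
    ‖modelPhase P τ - Complex.exp ((-(τ ^ 2 * ∑ q ∈ P, 1 / (q : ℝ)) / 2 : ℝ) : ℂ)‖ ≤
      5 * τ ^ 2 * (1 / z) + 2 * |τ| ^ 3 * ∑ q ∈ P, 1 / (q : ℝ) := by
  have hpos : ∀ q ∈ P, 0 < q := fun q hq => hz.trans (Finset.mem_Ioc.1 (hP hq)).1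
  have h1 : Complex.exp ((-(τ ^ 2 * ∑ q ∈ P, 1 / (q : ℝ)) / 2 : ℝ) : ℂ) =
      ∏ q ∈ P, Complex.exp ((-(τ ^ 2 / (2 * q)) : ℝ) : ℂ) := by
    rw [← Complex.exp_sum, ← Complex.ofReal_sum]
    congr 2
    rw [Finset.mul_sum, neg_div, Finset.sum_div, ← Finset.sum_neg_distrib]
    exact Finset.sum_congr rfl fun q _ => by ring
  rw [h1, modelPhase]
  refine (norm_prod_sub_prod_le P _ _ (fun q hq => norm_bernoulliFactor_le (hpos q hq) τ)
    fun q _ => ?_).trans ?_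
  · rw [← Complex.ofReal_exp, Complex.norm_real, Real.norm_of_nonneg (Real.exp_pos _).le,
      Real.exp_le_one_iff]
    have : 0 ≤ τ ^ 2 / (2 * q) := by positivity
    linarith
  · refine (Finset.sum_le_sum fun q hq => norm_bernoulliFactor_sub_exp_le (hpos q hq) hτ).trans ?_
    rw [Finset.sum_add_distrib, ← Finset.mul_sum, ← Finset.mul_sum]
    have := sum_one_div_sq_le hz hP
    gcongr

theorem abs_omega_sub_card_filter_le {z Y m : ℕ} (hm : 0 < m) (hY : 1 ≤ Y) :
    |(m.primeFactors.card : ℝ) -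
      ((((Finset.Ioc z Y).filter Nat.Prime).filter (· ∣ m)).card : ℝ)| ≤
      z + Real.log m / Real.log (Y + 1) := by
  set T := ((Finset.Ioc z Y).filter Nat.Prime).filter (· ∣ m) with hT
  have hTsub : T ⊆ m.primeFactors := by
    intro q hq
    rw [hT, Finset.mem_filter, Finset.mem_filter] at hq
    exact Nat.mem_primeFactors.2 ⟨hq.1.2, hq.2, hm.ne'⟩
  have hlogY : 0 < Real.log (Y + 1) := Real.log_pos (by
    have : (1 : ℝ) ≤ Y := by exact_mod_cast hY
    linarith)
  set B := m.primeFactors.filter (Y < ·) with hB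
  have hBcard : (B.card : ℝ) ≤ Real.log m / Real.log (Y + 1) := by
    rw [le_div_iff₀ hlogY]
    have h1 : (Y + 1) ^ B.card ≤ m := by
      calc (Y + 1) ^ B.card ≤ ∏ q ∈ B, q :=
            Finset.pow_card_le_prod _ _ _ fun q hq => (Finset.mem_filter.1 hq).2
        _ ≤ ∏ q ∈ m.primeFactors, q :=
            Finset.prod_le_prod_of_subset_of_one_le' (Finset.filter_subset _ _)
              fun q hq _ => (Nat.prime_of_mem_primeFactors hq).one_le
        _ ≤ m := Nat.le_of_dvd hm (Nat.prod_primeFactors_dvd m)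
    rw [← Real.log_pow]
    refine Real.log_le_log (by positivity) ?_
    exact_mod_cast h1
  have hcover : m.primeFactors ⊆ T ∪ (Finset.Ioc 0 z ∪ B) := by
    intro q hq
    have hq' := Nat.mem_primeFactors.1 hq
    simp only [hT, hB, Finset.mem_union, Finset.mem_filter, Finset.mem_Ioc]
    have := hq'.1.pos
    by_cases h1 : q ≤ z
    · right; left; exact ⟨this, h1⟩
    · by_cases h2 : q ≤ Y
      · left; exact ⟨⟨⟨not_le.1 h1, h2⟩, hq'.1⟩, hq'.2.1⟩
      · right; right; exact ⟨hq, not_le.1 h2⟩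
  have hle : m.primeFactors.card ≤ T.card + (z + B.card) := by
    refine (Finset.card_le_card hcover).trans ((Finset.card_union_le _ _).trans ?_)
    gcongr
    refine (Finset.card_union_le _ _).trans ?_
    simp
  have hle' : (m.primeFactors.card : ℝ) ≤ T.card + (z + B.card) := by exact_mod_cast hle
  have hge : (T.card : ℝ) ≤ m.primeFactors.card := by exact_mod_cast Finset.card_le_card hTsub
  rw [abs_of_nonneg (by linarith)]
  linarith

/-- The primes in the interval `(z, Y]`. -/
def primesIoc (z Y : ℕ) : Finset ℕ := (Finset.Ioc z Y).filter Nat.Prime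

theorem norm_centeredPhase (P : Finset ℕ) (τ : ℝ) (m : ℕ) : ‖centeredPhase P τ m‖ = 1 :=
  norm_exp_I_mul_ofReal _

theorem norm_modelPhase_le {P : Finset ℕ} (hP : ∀ q ∈ P, q.Prime) (τ : ℝ) :
    ‖modelPhase P τ‖ ≤ 1 := by
  rw [modelPhase, norm_prod]
  exact Finset.prod_le_one (fun q _ => norm_nonneg _)
    fun q hq => norm_bernoulliFactor_le (hP q hq).pos _

theorem modelError_le {a Y R : ℕ} {μ τ B T : ℝ} (ha : 2 ≤ a) (hY : 1 ≤ Y)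
    (hR : 2 ^ a * (2 * Y ^ 2) ^ (2 * a) ≤ R) (hτ : |τ| ≤ 1 / 4) (hT : τ ^ 2 ≤ T / a ^ 24)
    (hB : 4 * Real.exp (1 + 32 * τ ^ 2 * μ) ≤ B) :
    modelError Y (a ^ 10) a (a ^ 2) a R μ τ ≤ (8 + B) / 2 ^ a + 3 * T / a ^ 32 := by
  have ha0 : (0 : ℝ) < a := by exact_mod_cast (by omega : 0 < a)
  have ha2 : (2 : ℝ) ≤ a := by exact_mod_cast ha
  have hB0 : 0 ≤ B := le_trans (by positivity) hB
  have hY0 : (0 : ℝ) < Y := by exact_mod_cast hY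
  have hD : (0 : ℝ) < (2 * (Y : ℝ) ^ 2) ^ (2 * a) := by positivity
  have hR' : (2 : ℝ) ^ a * (2 * (Y : ℝ) ^ 2) ^ (2 * a) ≤ R := by exact_mod_cast hR
  have hR0 : (0 : ℝ) < R := lt_of_lt_of_le (by positivity) hR'
  have h1 : 6 * (2 * (Y : ℝ) ^ 2) ^ (2 * a) / R ≤ 6 / 2 ^ a := by
    rw [div_le_div_iff₀ hR0 (by positivity)]
    nlinarith
  have h2 : 4 * Real.exp (1 + 32 * τ ^ 2 * μ) / 4 ^ a ≤ B / 2 ^ a := by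
    gcongr
    norm_num
  have h3 : 2 * |τ| / 2 ^ a ≤ 2 / 2 ^ a := by
    gcongr
    linarith
  have h4 : τ ^ 2 * (1 + 2 * ((a ^ 2 : ℕ) : ℝ)) / ((a ^ 10 : ℕ) : ℝ) ≤ 3 * T / a ^ 32 := by
    push_cast
    have h5 : 1 + 2 * (a : ℝ) ^ 2 ≤ 3 * a ^ 2 := by nlinarith
    calc τ ^ 2 * (1 + 2 * (a : ℝ) ^ 2) / a ^ 10 ≤ (T / a ^ 24) * (3 * a ^ 2) / a ^ 10 := by
          gcongr
          exact (sq_nonneg τ).trans hT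
      _ = 3 * T / a ^ 32 := by field_simp
  have h5 : (8 + B) / 2 ^ a = 6 / 2 ^ a + B / 2 ^ a + 2 / 2 ^ a := by ring
  rw [modelError, h5]
  linarith

theorem sum_Icc_one_eq_sum_range {M : Type*} [AddCommMonoid M] (R : ℕ) (f : ℕ → M) :
    ∑ r ∈ Finset.Icc 1 R, f r = ∑ r ∈ Finset.range R, f (r + 1) := by
  rw [← Finset.sum_image (g := fun r => r + 1) (by intro a _ b _ h; simpa using h)]
  congr 1
  ext r
  simp only [Finset.mem_Icc, Finset.mem_image, Finset.mem_range]
  constructor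
  · rintro ⟨h1, h2⟩
    exact ⟨r - 1, by omega, by omega⟩
  · rintro ⟨s, hs, rfl⟩
    omega

theorem norm_sum_centeredPhase_sub_modelPhase_le {a Y N : ℕ} {τ B T H : ℝ} (ha : 2 ≤ a)
    (hK : a ^ 27 < 2 ^ a) (hY : 1 ≤ Y)
    (hN : 2 ^ a * (2 * Y ^ 2) ^ (2 * a) * 2 ^ (a ^ 2) ≤ N) (hτ : |τ| ≤ 1 / 4)
    (hT : τ ^ 2 ≤ T / a ^ 24)
    (hB : 4 * Real.exp (1 + 32 * τ ^ 2 * ∑ q ∈ primesIoc (a ^ 10) Y, 1 / (q : ℝ)) ≤ B)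
    (hH : ∑ p ∈ (Finset.range (N + 1)).filter Nat.Prime, 1 / (p : ℝ) ≤ H * a ^ 24)
    (hS : 1 ≤ ∑ p ∈ dyadicPrimes a (a ^ 2), 1 / (p : ℝ)) :
    ‖∑ n ∈ Finset.Icc 1 N, (centeredPhase (primesIoc (a ^ 10) Y) τ (n + n.primeFactors.card) -
        modelPhase (primesIoc (a ^ 10) Y) τ)‖ ≤
      N * (4 / √(∑ p ∈ dyadicPrimes a (a ^ 2), 1 / (p : ℝ)) + 4 / 2 ^ a + (2 * H / a +
        √(a ^ 31 * (4 / 2 ^ a + 3 * ((8 + B) / 2 ^ a + 3 * T / a ^ 32))))) := by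
  set P := primesIoc (a ^ 10) Y with hP
  set ε : ℝ := 3 * ((8 + B) / 2 ^ a + 3 * T / a ^ 32) with hε
  set S := ∑ p ∈ dyadicPrimes a (a ^ 2), 1 / (p : ℝ) with hSdef
  have ha0 : 0 < a := by omega
  have ha0' : (0 : ℝ) < a := by exact_mod_cast ha0
  have hPprime : ∀ q ∈ P, q.Prime := fun q hq => (Finset.mem_filter.1 hq).2
  have hB0 : 0 ≤ B := le_trans (by positivity) hB
  have hT0 : 0 ≤ T := by
    have := (sq_nonneg τ).trans hT
    rwa [le_div_iff₀ (by positivity), zero_mul] at this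
  have hε0 : 0 ≤ ε := by positivity
  have hD1 : 1 ≤ 2 ^ a * (2 * Y ^ 2) ^ (2 * a) := Nat.one_le_iff_ne_zero.2 (by positivity)
  have hcorr : ∀ p ∈ dyadicPrimes a (a ^ 2), ∀ p' ∈ dyadicPrimes a (a ^ 2), p ≠ p' →
      ∀ k ∈ Finset.Icc 1 (a ^ 27),
      ‖∑ r ∈ Finset.Icc 1 (N / max p p'), (centeredPhase P τ (p * r + k) - modelPhase P τ) *
        (starRingEnd ℂ) (centeredPhase P τ (p' * r + k) - modelPhase P τ)‖ ≤
        ε * (N / max p p' : ℕ) := by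
    intro p hp p' hp' hne k hk
    obtain ⟨hp1, hp2⟩ := Finset.mem_filter.1 hp
    obtain ⟨hp1', hp2'⟩ := Finset.mem_filter.1 hp'
    rw [Finset.mem_Ico] at hp1 hp1'
    rw [Finset.mem_Icc] at hk
    have hR : 2 ^ a * (2 * Y ^ 2) ^ (2 * a) ≤ N / max p p' := by
      rw [Nat.le_div_iff_mul_le (lt_max_of_lt_left hp2.pos)]
      refine le_trans ?_ hN
      gcongr
      exact max_le hp1.2.le hp1'.2.le
    set R := N / max p p' with hRdef
    have hR0 : 0 < R := lt_of_lt_of_le hD1 hR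
    rw [sum_Icc_one_eq_sum_range, ← natCast_mul_rangeAvg, norm_mul, Complex.norm_natCast, mul_comm]
    gcongr
    refine (norm_rangeAvg_correlation_le (J := a) (pow_pos ha0 10) hY (Finset.filter_subset _ _)
      hPprime le_rfl hτ hp2 hp2' hne hp1.1 hp1'.1 hp1.2 hp1'.2 hk.1
      (by omega) (by omega) hR0).trans ?_
    rw [hε]
    gcongr
    exact modelError_le ha hY hR hτ hT hB
  have hmain := norm_sum_add_omega_le (N := N)
    (G := fun m => centeredPhase P τ m - modelPhase P τ) hε0 (pow_pos ha0 27)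
    (fun m => (norm_sub_le _ _).trans (by
      rw [norm_centeredPhase]; linarith [norm_modelPhase_le hPprime τ])) hcorr hH
    ((Nat.le_mul_of_pos_left _ hD1).trans hN)
  rw [← hSdef] at hmain
  have hS0 : 0 < S := by linarith
  rw [mul_comm, ← le_div_iff₀ hS0] at hmain
  refine hmain.trans ?_
  rw [mul_div_assoc]
  gcongr
  rw [div_le_iff₀ hS0, add_mul, add_mul]
  have h1 : 4 * √S = 4 / √S * S := by
    have : 0 < √S := Real.sqrt_pos.2 hS0
    rw [div_mul_eq_mul_div, eq_div_iff this.ne', mul_assoc, Real.mul_self_sqrt hS0.le]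
  have h2 : ((a ^ 2 : ℕ) : ℝ) * (2 * (H * a ^ 24) / ((a ^ 27 : ℕ) : ℝ) +
      √(((a ^ 27 : ℕ) : ℝ) * (4 / 2 ^ a + ε))) =
      2 * H / a + √(a ^ 31 * (4 / 2 ^ a + ε)) := by
    push_cast
    rw [mul_add]
    congr 1
    · field_simp
    · have : (a : ℝ) ^ 31 * (4 / 2 ^ a + ε) = (a ^ 2) ^ 2 * (a ^ 27 * (4 / 2 ^ a + ε)) := by ring
      rw [this, Real.sqrt_mul (sq_nonneg ((a : ℝ) ^ 2)), Real.sqrt_sq (by positivity)]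
  have hH0 : 0 ≤ H := by
    have := (Finset.sum_nonneg fun p _ => by positivity).trans hH
    exact nonneg_of_mul_nonneg_left this (by positivity)
  have h3 : 2 * H / a + √(a ^ 31 * (4 / 2 ^ a + ε)) ≤
      (2 * H / a + √(a ^ 31 * (4 / 2 ^ a + ε))) * S :=
    le_mul_of_one_le_right (by positivity) hS
  rw [h2, h1]
  have h4 : 4 * S / 2 ^ a = 4 / 2 ^ a * S := by ring
  linarith

theorem norm_exp_I_mul_sub_exp_I_mul_le (x y : ℝ) :
    ‖Complex.exp (Complex.I * x) - Complex.exp (Complex.I * y)‖ ≤ |x - y| := by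
  have h : Complex.exp (Complex.I * x) - Complex.exp (Complex.I * y) =
      Complex.exp (Complex.I * y) * (Complex.exp (Complex.I * ((x - y : ℝ) : ℂ)) - 1) := by
    rw [mul_sub, ← Complex.exp_add, mul_one]
    congr 2
    push_cast
    ring
  rw [h, norm_mul, norm_exp_I_mul_ofReal, one_mul]
  exact norm_exp_I_mul_sub_one_le _

theorem abs_exp_neg_sub_exp_neg_le {x y : ℝ} (hx : 0 ≤ x) (hy : 0 ≤ y) :
    |Real.exp (-x) - Real.exp (-y)| ≤ |x - y| := by
  wlog h : x ≤ y generalizing x y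
  · rw [abs_sub_comm, abs_sub_comm x y]
    exact this hy hx (le_of_not_ge h)
  rw [abs_of_nonneg (sub_nonneg.2 (Real.exp_le_exp.2 (by linarith))), abs_of_nonpos (by linarith)]
  have h1 : Real.exp (-y) = Real.exp (-x) * Real.exp (-(y - x)) := by
    rw [← Real.exp_add]; ring_nf
  have h2 : Real.exp (-x) ≤ 1 := Real.exp_le_one_iff.2 (by linarith)
  have h3 : 1 - (y - x) ≤ Real.exp (-(y - x)) := by linarith [Real.add_one_le_exp (-(y - x))]
  rw [h1]
  nlinarith [Real.exp_pos (-x)]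

theorem card_primeFactors_le_self (n : ℕ) : n.primeFactors.card ≤ n := by
  calc n.primeFactors.card ≤ (Finset.Icc 1 n).card := Finset.card_le_card fun p hp =>
        Finset.mem_Icc.2 ⟨(Nat.prime_of_mem_primeFactors hp).one_le, Nat.le_of_mem_primeFactors hp⟩
    _ = n := by simp

theorem norm_phase_sub_centeredPhase_le {z Y N m : ℕ} (hm : 0 < m) (hmN : m ≤ 2 * N) (hY : 1 ≤ Y)
    (τ L : ℝ) :
    ‖Complex.exp (Complex.I * ((τ * (m.primeFactors.card - L) : ℝ) : ℂ)) -
      Complex.exp (Complex.I * ((τ * (∑ q ∈ primesIoc z Y, 1 / (q : ℝ) - L) : ℝ) : ℂ)) *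
        centeredPhase (primesIoc z Y) τ m‖ ≤
      |τ| * (z + Real.log (2 * N) / Real.log (Y + 1)) := by
  have h1 : (∑ q ∈ primesIoc z Y, ((if q ∣ m then 1 else 0) - 1 / (q : ℝ))) =
      (((primesIoc z Y).filter (· ∣ m)).card : ℝ) - ∑ q ∈ primesIoc z Y, 1 / (q : ℝ) := by
    rw [Finset.sum_sub_distrib, Finset.sum_boole]
  rw [centeredPhase, h1, ← Complex.exp_add, ← mul_add, ← Complex.ofReal_add]
  refine (norm_exp_I_mul_sub_exp_I_mul_le _ _).trans ?_
  have h2 : τ * (m.primeFactors.card - L) - (τ * (∑ q ∈ primesIoc z Y, 1 / (q : ℝ) - L) +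
      τ * ((((primesIoc z Y).filter (· ∣ m)).card : ℝ) - ∑ q ∈ primesIoc z Y, 1 / (q : ℝ))) =
      τ * (m.primeFactors.card - (((primesIoc z Y).filter (· ∣ m)).card : ℝ)) := by ring
  rw [h2, abs_mul]
  gcongr
  refine (abs_omega_sub_card_filter_le (z := z) hm hY).trans ?_
  have hlogY : 0 ≤ Real.log (Y + 1) := Real.log_nonneg (by
    have : (0 : ℝ) ≤ Y := Nat.cast_nonneg _
    linarith)
  have : (m : ℝ) ≤ 2 * N := by exact_mod_cast hmN
  gcongr

theorem norm_avg_phase_sub_exp_le {z Y N : ℕ} {τ L E : ℝ} (hz : 0 < z) (hY : 1 ≤ Y) (hN : 0 < N)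
    (hτ : |τ| ≤ 1) (hL : 0 ≤ L)
    (hE : ‖∑ n ∈ Finset.Icc 1 N, (centeredPhase (primesIoc z Y) τ (n + n.primeFactors.card) -
      modelPhase (primesIoc z Y) τ)‖ ≤ N * E) :
    ‖(N : ℂ)⁻¹ * ∑ n ∈ Finset.Icc 1 N, Complex.exp (Complex.I *
        ((τ * ((n + n.primeFactors.card).primeFactors.card - L) : ℝ) : ℂ)) -
        Complex.exp ((-(τ ^ 2 * L) / 2 : ℝ) : ℂ)‖ ≤
      |τ| * (z + Real.log (2 * N) / Real.log (Y + 1)) + E +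
        (|τ| * |∑ q ∈ primesIoc z Y, 1 / (q : ℝ) - L| +
          τ ^ 2 * |∑ q ∈ primesIoc z Y, 1 / (q : ℝ) - L| +
          (5 * τ ^ 2 * (1 / z) + 2 * |τ| ^ 3 * ∑ q ∈ primesIoc z Y, 1 / (q : ℝ))) := by
  set P := primesIoc z Y with hP
  set μ := ∑ q ∈ P, 1 / (q : ℝ) with hμ
  have hμ0 : 0 ≤ μ := Finset.sum_nonneg fun _ _ => by positivity
  have hNc : (N : ℂ) ≠ 0 := by exact_mod_cast hN.ne'
  have hNr : (0 : ℝ) < N := by exact_mod_cast hN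
  set e := Complex.exp (Complex.I * ((τ * (μ - L) : ℝ) : ℂ)) with he
  set M := modelPhase P τ with hM
  set f : ℕ → ℂ := fun n => Complex.exp (Complex.I *
        ((τ * ((n + n.primeFactors.card).primeFactors.card - L) : ℝ) : ℂ)) with hf
  set g : ℕ → ℂ := fun n => centeredPhase P τ (n + n.primeFactors.card) with hg
  have he1 : ‖e‖ = 1 := norm_exp_I_mul_ofReal _
  have h1 : ‖(N : ℂ)⁻¹ * ∑ n ∈ Finset.Icc 1 N, (f n - e * g n)‖ ≤
      |τ| * (z + Real.log (2 * N) / Real.log (Y + 1)) := by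
    rw [norm_mul, norm_inv, Complex.norm_natCast, inv_mul_le_iff₀ hNr]
    refine (norm_sum_le_of_le _ fun n hn => ?_).trans_eq
      (b := ∑ _n ∈ Finset.Icc 1 N, |τ| * (z + Real.log (2 * N) / Real.log (Y + 1))) (by simp)
    rw [Finset.mem_Icc] at hn
    have := card_primeFactors_le_self n
    exact norm_phase_sub_centeredPhase_le (by omega) (by omega) hY τ L
  have h2 : ‖e * ((N : ℂ)⁻¹ * ∑ n ∈ Finset.Icc 1 N, (g n - M))‖ ≤ E := by
    rw [norm_mul, he1, one_mul, norm_mul, norm_inv, Complex.norm_natCast, inv_mul_le_iff₀ hNr]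
    exact hE
  have h3 := norm_modelPhase_sub_exp_le (τ := τ) hz
    (Finset.filter_subset Nat.Prime (Finset.Ioc z Y)) hτ
  change ‖M - Complex.exp ((-(τ ^ 2 * μ) / 2 : ℝ) : ℂ)‖ ≤
    5 * τ ^ 2 * (1 / z) + 2 * |τ| ^ 3 * μ at h3
  have h4 : ‖Complex.exp ((-(τ ^ 2 * μ) / 2 : ℝ) : ℂ) - Complex.exp ((-(τ ^ 2 * L) / 2 : ℝ) : ℂ)‖ ≤
      τ ^ 2 * |μ - L| := by
    rw [← Complex.ofReal_exp, ← Complex.ofReal_exp, ← Complex.ofReal_sub, Complex.norm_real,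
      Real.norm_eq_abs, neg_div, neg_div]
    refine (abs_exp_neg_sub_exp_neg_le (by positivity) (by positivity)).trans ?_
    have : τ ^ 2 * μ / 2 - τ ^ 2 * L / 2 = τ ^ 2 / 2 * (μ - L) := by ring
    rw [this, abs_mul, abs_of_nonneg (by positivity)]
    gcongr
    linarith [sq_nonneg τ]
  have h5 : ‖(e - 1) * M‖ ≤ |τ| * |μ - L| := by
    rw [norm_mul, ← abs_mul]
    have hM1 : ‖M‖ ≤ 1 := norm_modelPhase_le (fun q hq => (Finset.mem_filter.1 hq).2) τ
    exact (mul_le_of_le_one_right (norm_nonneg _) hM1).trans (norm_exp_I_mul_sub_one_le _)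
  have hsplit : (N : ℂ)⁻¹ * ∑ n ∈ Finset.Icc 1 N, f n - Complex.exp ((-(τ ^ 2 * L) / 2 : ℝ) : ℂ) =
      (N : ℂ)⁻¹ * ∑ n ∈ Finset.Icc 1 N, (f n - e * g n) +
      e * ((N : ℂ)⁻¹ * ∑ n ∈ Finset.Icc 1 N, (g n - M)) +
      ((e - 1) * M + (Complex.exp ((-(τ ^ 2 * μ) / 2 : ℝ) : ℂ) -
        Complex.exp ((-(τ ^ 2 * L) / 2 : ℝ) : ℂ)) +
        (M - Complex.exp ((-(τ ^ 2 * μ) / 2 : ℝ) : ℂ))) := by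
    rw [Finset.sum_sub_distrib, Finset.sum_sub_distrib, ← Finset.mul_sum, Finset.sum_const,
      Nat.card_Icc, nsmul_eq_mul, Nat.add_sub_cancel]
    field_simp
    ring
  rw [hsplit]
  refine norm_add₃_le.trans (add_le_add (add_le_add h1 h2) ?_)
  exact norm_add₃_le.trans (add_le_add (add_le_add h5 h4) h3)

theorem sum_primesIoc_eq {z Y : ℕ} (h : z ≤ Y) :
    ∑ q ∈ primesIoc z Y, 1 / (q : ℝ) =
      ∑ q ∈ (Finset.range (Y + 1)).filter Nat.Prime, 1 / (q : ℝ) -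
        ∑ q ∈ (Finset.range (z + 1)).filter Nat.Prime, 1 / (q : ℝ) := by
  rw [eq_sub_iff_add_eq, primesIoc, ← Finset.sum_union]
  · congr 1
    ext q
    simp only [Finset.mem_union, Finset.mem_filter, Finset.mem_Ioc, Finset.mem_range]
    constructor
    · rintro (⟨h1, h2⟩ | ⟨h1, h2⟩) <;> exact ⟨by omega, h2⟩
    · rintro ⟨h1, h2⟩
      by_cases h3 : z < q
      · exact Or.inl ⟨⟨h3, by omega⟩, h2⟩
      · exact Or.inr ⟨by omega, h2⟩
  · rw [Finset.disjoint_left]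
    intro q h1 h2
    simp only [Finset.mem_filter, Finset.mem_Ioc, Finset.mem_range] at h1 h2
    omega

theorem log_sub_le_sum_dyadicPrimes {C : ℝ}
    (hC : ∀ x : ℝ, 2 ≤ x → |∑ p ∈ (Finset.range (⌊x⌋₊ + 1)).filter Nat.Prime, 1 / (p : ℝ) -
      Real.log (Real.log x)| ≤ C) {a : ℕ} (ha : 1 ≤ a) :
    Real.log a - (2 * C + 1) ≤ ∑ p ∈ dyadicPrimes a (a ^ 2), 1 / (p : ℝ) := by
  have ha0 : (0 : ℝ) < a := by exact_mod_cast ha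
  have key : ∀ n : ℕ, 1 ≤ n → |∑ p ∈ (Finset.range (2 ^ n + 1)).filter Nat.Prime, 1 / (p : ℝ) -
      (Real.log n + Real.log (Real.log 2))| ≤ C := by
    intro n hn
    have h2 : (2 : ℝ) ≤ ((2 ^ n : ℕ) : ℝ) := by
      exact_mod_cast Nat.le_self_pow (by omega) 2
    have := hC _ h2
    rw [Nat.floor_natCast, Nat.cast_pow, Real.log_pow, Real.log_mul] at this
    · exact_mod_cast this
    · exact_mod_cast (by omega : n ≠ 0)
    · exact (Real.log_pos (by norm_num)).ne'
  have h1 := abs_le.1 (key a ha)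
  have h2 := abs_le.1 (key (a ^ 2) (Nat.one_le_pow _ _ ha))
  rw [Nat.cast_pow, Real.log_pow] at h2
  have hsub : (Finset.range (2 ^ a ^ 2 + 1)).filter Nat.Prime ⊆
      (Finset.range (2 ^ a + 1)).filter Nat.Prime ∪ (dyadicPrimes a (a ^ 2) ∪ {2 ^ a ^ 2}) := by
    intro p hp
    simp only [dyadicPrimes, Finset.mem_union, Finset.mem_filter, Finset.mem_range, Finset.mem_Ico,
      Finset.mem_singleton] at hp ⊢
    by_cases h3 : p < 2 ^ a + 1
    · exact Or.inl ⟨h3, hp.2⟩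
    · by_cases h4 : p = 2 ^ a ^ 2
      · exact Or.inr (Or.inr h4)
      · exact Or.inr (Or.inl ⟨⟨by omega, by omega⟩, hp.2⟩)
  have hnn : ∀ s : Finset ℕ, 0 ≤ ∑ p ∈ s, 1 / (p : ℝ) :=
    fun s => Finset.sum_nonneg fun _ _ => by positivity
  have hun : ∀ s t : Finset ℕ,
      ∑ p ∈ s ∪ t, 1 / (p : ℝ) ≤ ∑ p ∈ s, 1 / (p : ℝ) + ∑ p ∈ t, 1 / (p : ℝ) := by
    intro s t
    rw [← Finset.sum_union_inter]
    linarith [hnn (s ∩ t)]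
  have h3 := (Finset.sum_le_sum_of_subset_of_nonneg (f := fun p : ℕ => 1 / (p : ℝ)) hsub
    fun p _ _ => by positivity).trans ((hun _ _).trans (add_le_add_right (hun _ _) _))
  rw [Finset.sum_singleton] at h3
  have h4 : 1 / ((2 ^ a ^ 2 : ℕ) : ℝ) ≤ 1 := by
    rw [div_le_one (by positivity)]
    exact_mod_cast Nat.one_le_two_pow
  push_cast at h2
  linarith

/-- The bound for the mean deviation, in terms of the scale `a`. -/
def deviationBound (C t : ℝ) (a : ℕ) : ℝ :=
  4 / √(∑ p ∈ dyadicPrimes a (a ^ 2), 1 / (p : ℝ)) + 4 / 2 ^ a + (2 * (2 ^ 24 + C) / a +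
    √(a ^ 31 * (4 / 2 ^ a + 3 * ((8 + 4 * Real.exp (1 + 32 * (t ^ 2 * (21 + 2 * C)))) / 2 ^ a +
      3 * t ^ 2 / a ^ 32))))

theorem two_pow_mul_pow_mul_two_pow_le {a Y : ℕ} {v ℓ : ℝ} (hv : 2 ≤ v) (ha : (a : ℝ) ≤ v)
    (hℓ : v ^ 24 ≤ ℓ) (hY : (Y : ℝ) ≤ Real.exp (ℓ / v ^ 10)) :
    (2 : ℝ) ^ a * (2 * (Y : ℝ) ^ 2) ^ (2 * a) * 2 ^ (a ^ 2) ≤ Real.exp ℓ := by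
  have hv0 : 0 < v := by linarith
  have hℓ0 : 0 < ℓ := lt_of_lt_of_le (by positivity) hℓ
  have ha0 : (0 : ℝ) ≤ a := Nat.cast_nonneg _
  have h2 : (2 : ℝ) ≤ Real.exp 1 := by linarith [Real.add_one_le_exp 1]
  have h1 : (2 : ℝ) ^ a * (2 * (Y : ℝ) ^ 2) ^ (2 * a) * 2 ^ (a ^ 2) =
      2 ^ (3 * a + a ^ 2) * (Y : ℝ) ^ (4 * a) := by
    rw [mul_pow, ← pow_mul]; ring
  rw [h1]
  calc (2 : ℝ) ^ (3 * a + a ^ 2) * (Y : ℝ) ^ (4 * a)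
      ≤ Real.exp 1 ^ (3 * a + a ^ 2) * Real.exp (ℓ / v ^ 10) ^ (4 * a) := by gcongr
    _ = Real.exp (3 * a + a ^ 2 + 4 * a * (ℓ / v ^ 10)) := by
        rw [← Real.exp_nat_mul, ← Real.exp_nat_mul, ← Real.exp_add]
        push_cast
        ring_nf
    _ ≤ Real.exp ℓ := by
        gcongr
        have h3 : 4 * a * (ℓ / v ^ 10) ≤ ℓ / 2 := by
          rw [mul_div_assoc', div_le_div_iff₀ (by positivity) (by norm_num)]
          have h4 : (8 : ℝ) ≤ v ^ 9 := by
            calc (8 : ℝ) ≤ 2 ^ 9 := by norm_num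
              _ ≤ v ^ 9 := by gcongr
          calc 4 * a * ℓ * 2 = ℓ * (8 * a) := by ring
            _ ≤ ℓ * (v ^ 9 * v) := by gcongr
            _ = ℓ * v ^ 10 := by ring
        have h5 : 3 * (a : ℝ) + a ^ 2 ≤ ℓ / 2 := by
          have h6 : 3 * (a : ℝ) + a ^ 2 ≤ 4 * v ^ 2 := by nlinarith
          have h7 : (8 : ℝ) ≤ v ^ 22 := by
            calc (8 : ℝ) ≤ 2 ^ 22 := by norm_num
              _ ≤ v ^ 22 := by gcongr
          have h8 : 8 * v ^ 2 ≤ v ^ 24 := by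
            calc 8 * v ^ 2 ≤ v ^ 22 * v ^ 2 := by gcongr
              _ = v ^ 24 := by ring
          linarith
        linarith

set_option maxHeartbeats 1000000 in
theorem norm_avg_phase_sub_exp_le_deviationBound {C : ℝ} (hC0 : 0 ≤ C)
    (hC : ∀ x : ℝ, 2 ≤ x → |∑ p ∈ (Finset.range (⌊x⌋₊ + 1)).filter Nat.Prime, 1 / (p : ℝ) -
      Real.log (Real.log x)| ≤ C) {x v t : ℝ} (hx : 2 ≤ x) (hv : 2 ≤ v)
    (hvL : v ^ 24 = Real.log (Real.log x)) (hK : ⌊v⌋₊ ^ 27 < 2 ^ ⌊v⌋₊) (ht : |t / v ^ 12| ≤ 1 / 4)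
    (hS : 1 ≤ ∑ p ∈ dyadicPrimes ⌊v⌋₊ (⌊v⌋₊ ^ 2), 1 / (p : ℝ)) :
    ‖(⌊x⌋₊ : ℂ)⁻¹ * ∑ n ∈ Finset.Icc 1 ⌊x⌋₊, Complex.exp (Complex.I *
        ((t / v ^ 12 * ((n + n.primeFactors.card).primeFactors.card - v ^ 24) : ℝ) : ℂ)) -
        Complex.exp ((-t ^ 2 / 2 : ℝ) : ℂ)‖ ≤
      deviationBound C t ⌊v⌋₊ +
        (3 * |t| + 2 * (|t| * (20 + 2 * C)) + 5 * |t| + 2 * (|t| ^ 3 * (21 + 2 * C))) / v := by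
  set a := ⌊v⌋₊ with ha
  set τ := t / v ^ 12 with hτ
  set ℓ := Real.log x with hℓ
  have hv0 : 0 < v := by linarith
  have hv1 : 1 ≤ v := by linarith
  have hav : (a : ℝ) ≤ v := Nat.floor_le hv0.le
  have hva : v < a + 1 := Nat.lt_floor_add_one v
  have ha2 : 2 ≤ a := Nat.le_floor (by exact_mod_cast hv)
  have ha0 : (0 : ℝ) < a := by exact_mod_cast (by omega : 0 < a)
  have ha2' : (2 : ℝ) ≤ a := by exact_mod_cast ha2
  have hℓ0 : 0 < ℓ := Real.log_pos (by linarith)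
  have hℓexp : ℓ = Real.exp (v ^ 24) := by rw [hvL, Real.exp_log hℓ0]
  have hℓv : v ^ 24 ≤ ℓ := by rw [hℓexp]; linarith [Real.add_one_le_exp (v ^ 24)]
  have hℓ1 : 1 ≤ ℓ := (one_le_pow₀ hv1).trans hℓv
  have hxexp : Real.exp ℓ = x := Real.exp_log (by linarith)
  set y := Real.exp (ℓ / v ^ 10) with hy
  set Y := ⌊y⌋₊ with hYdef
  have hyv : v ^ 10 ≤ y := by
    have h1 : v ^ 10 ≤ ℓ / v ^ 10 := by
      rw [le_div_iff₀ (by positivity), ← pow_add]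
      exact (pow_le_pow_right₀ hv1 (by norm_num)).trans hℓv
    linarith [Real.add_one_le_exp (ℓ / v ^ 10)]
  have hza : ((a ^ 10 : ℕ) : ℝ) ≤ v ^ 10 := by push_cast; gcongr
  have hzY : a ^ 10 ≤ Y := Nat.le_floor (hza.trans hyv)
  have hz2 : 2 ≤ a ^ 10 := ha2.trans (Nat.le_self_pow (by norm_num) a)
  have hY1 : 1 ≤ Y := by omega
  have hyY : y < Y + 1 := Nat.lt_floor_add_one y
  have hYy : (Y : ℝ) ≤ y := Nat.floor_le (Real.exp_pos _).le
  have hy2 : 2 ≤ y := by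
    have : (2 : ℝ) ≤ Y := by exact_mod_cast hz2.trans hzY
    linarith
  have hN1 : 1 ≤ ⌊x⌋₊ := Nat.le_floor (by norm_num; linarith)
  set μ := ∑ q ∈ primesIoc (a ^ 10) Y, 1 / (q : ℝ) with hμ
  have hμL : |μ - v ^ 24| ≤ (20 + 2 * C) * v := by
    have h1 := abs_le.1 (hC y hy2)
    have h2 := abs_le.1 (hC ((a ^ 10 : ℕ) : ℝ) (by exact_mod_cast hz2))
    rw [Nat.floor_natCast] at h2
    have h3 := sum_primesIoc_eq hzY
    have h4 : Real.log (Real.log y) = v ^ 24 - 10 * Real.log v := by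
      rw [hy, Real.log_exp, Real.log_div hℓ0.ne' (by positivity), Real.log_pow, hvL]
      norm_num
    have h5 : Real.log ((a ^ 10 : ℕ) : ℝ) = 10 * Real.log a := by
      push_cast; rw [Real.log_pow]; norm_num
    have hla : 0.5 ≤ Real.log a := by
      have := Real.log_le_log (by norm_num) ha2'
      linarith [Real.log_two_gt_d9]
    have hlav : Real.log a ≤ v := (Real.log_le_self ha0.le).trans hav
    have h6 : Real.log (10 * Real.log a) ≤ 10 * v :=
      (Real.log_le_self (by linarith)).trans (by linarith)
    have h7 : 0 ≤ Real.log (10 * Real.log a) := Real.log_nonneg (by linarith)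
    have h8 : Real.log v ≤ v := Real.log_le_self hv0.le
    have h9 : 0 ≤ Real.log v := Real.log_nonneg hv1
    rw [h4] at h1
    rw [h5] at h2
    have hCv : C ≤ C * v := le_mul_of_one_le_right hC0 hv1
    rw [abs_le]
    constructor <;> nlinarith
  have hμ0 : 0 ≤ μ := Finset.sum_nonneg fun _ _ => by positivity
  have hμle : μ ≤ (21 + 2 * C) * v ^ 24 := by
    have h1 := (abs_le.1 hμL).2
    have h2 : v ≤ v ^ 24 := le_self_pow₀ hv1 (by norm_num)
    have h3 : (20 + 2 * C) * v ≤ (20 + 2 * C) * v ^ 24 := by gcongr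
    linarith
  have hτ2 : τ ^ 2 = t ^ 2 / v ^ 24 := by rw [hτ, div_pow, ← pow_mul]
  have hE := norm_sum_centeredPhase_sub_modelPhase_le (N := ⌊x⌋₊) (Y := Y) (τ := τ) (T := t ^ 2)
    (B := 4 * Real.exp (1 + 32 * (t ^ 2 * (21 + 2 * C)))) (H := 2 ^ 24 + C) ha2 hK hY1 ?_ ht ?_ ?_
    ?_ hS
  rotate_left
  · refine Nat.le_floor ?_
    push_cast
    exact (two_pow_mul_pow_mul_two_pow_le hv hav hℓv hYy).trans_eq hxexp
  · rw [hτ2]; gcongr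
  · have h1 : τ ^ 2 * μ ≤ t ^ 2 * (21 + 2 * C) := by
      rw [hτ2]
      calc t ^ 2 / v ^ 24 * μ ≤ t ^ 2 / v ^ 24 * ((21 + 2 * C) * v ^ 24) := by gcongr
        _ = t ^ 2 * (21 + 2 * C) := by field_simp
    have h2 : 1 + 32 * τ ^ 2 * μ ≤ 1 + 32 * (t ^ 2 * (21 + 2 * C)) := by linarith
    have h3 := Real.exp_le_exp.2 h2
    linarith
  · have h1 := (abs_le.1 (hC x hx)).2
    have h2 : v ^ 24 ≤ 2 ^ 24 * a ^ 24 := by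
      rw [← mul_pow]
      gcongr
      linarith
    have h3 : C ≤ C * a ^ 24 := le_mul_of_one_le_right hC0 (one_le_pow₀ (by linarith))
    linarith
  have hmain := norm_avg_phase_sub_exp_le (L := v ^ 24) (by omega : 0 < a ^ 10) hY1 hN1
    (ht.trans (by norm_num)) (by positivity) hE
  clear_value τ μ Y y ℓ a
  have hexp : -(τ ^ 2 * v ^ 24) / 2 = -t ^ 2 / 2 := by rw [hτ2]; field_simp
  rw [hexp, ← hμ] at hmain
  refine hmain.trans ?_
  have habs : |τ| = |t| / v ^ 12 := by rw [hτ, abs_div, abs_of_pos (pow_pos hv0 12)]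
  have hτ1 : |τ| ≤ 1 := ht.trans (by norm_num)
  have hτsq : τ ^ 2 ≤ |τ| := by
    rw [← sq_abs, sq]
    exact mul_le_of_le_one_left (abs_nonneg _) hτ1
  have b1 : |τ| * (((a ^ 10 : ℕ) : ℝ) + Real.log (2 * ⌊x⌋₊) / Real.log (Y + 1)) ≤
      3 * |t| / v := by
    have h1 : Real.log (2 * ⌊x⌋₊) ≤ 2 * ℓ := by
      have hN0 : (0 : ℝ) < ⌊x⌋₊ := by exact_mod_cast hN1
      rw [Real.log_mul (by norm_num) hN0.ne']
      have := Real.log_le_log hN0 (Nat.floor_le (by linarith : 0 ≤ x))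
      linarith [Real.log_two_lt_d9]
    have h2 : ℓ / v ^ 10 ≤ Real.log (Y + 1) := by
      rw [Real.le_log_iff_exp_le (by positivity)]
      exact hy ▸ hyY.le
    have h3 : Real.log (2 * ⌊x⌋₊) / Real.log (Y + 1) ≤ 2 * v ^ 10 := by
      calc Real.log (2 * ⌊x⌋₊) / Real.log (Y + 1) ≤ 2 * ℓ / (ℓ / v ^ 10) := by gcongr
        _ = 2 * v ^ 10 := by field_simp
    calc |τ| * (((a ^ 10 : ℕ) : ℝ) + Real.log (2 * ⌊x⌋₊) / Real.log (Y + 1))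
        ≤ |t| / v ^ 12 * (v ^ 10 + 2 * v ^ 10) := by rw [habs]; gcongr
      _ = 3 * |t| / v ^ 2 := by field_simp; ring
      _ ≤ 3 * |t| / v := by gcongr; exact le_self_pow₀ hv1 (by norm_num)
  have b2 : |τ| * |μ - v ^ 24| ≤ |t| * (20 + 2 * C) / v := by
    calc |τ| * |μ - v ^ 24| ≤ |t| / v ^ 12 * ((20 + 2 * C) * v) := by rw [habs]; gcongr
      _ = |t| * (20 + 2 * C) / v ^ 11 := by field_simp
      _ ≤ |t| * (20 + 2 * C) / v := by gcongr; exact le_self_pow₀ hv1 (by norm_num)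
  have b3 : τ ^ 2 * |μ - v ^ 24| ≤ |t| * (20 + 2 * C) / v := le_trans (by gcongr) b2
  have b4 : 5 * τ ^ 2 * (1 / ((a ^ 10 : ℕ) : ℝ)) ≤ 5 * |t| / v := by
    have h1 : 1 / ((a ^ 10 : ℕ) : ℝ) ≤ 1 := by
      rw [div_le_one (by positivity)]
      exact_mod_cast (by omega : 1 ≤ a ^ 10)
    calc 5 * τ ^ 2 * (1 / ((a ^ 10 : ℕ) : ℝ)) ≤ 5 * |τ| * 1 := by gcongr
      _ = 5 * |t| / v ^ 12 := by rw [habs]; ring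
      _ ≤ 5 * |t| / v := by gcongr; exact le_self_pow₀ hv1 (by norm_num)
  have b5 : 2 * |τ| ^ 3 * μ ≤ 2 * (|t| ^ 3 * (21 + 2 * C)) / v := by
    calc 2 * |τ| ^ 3 * μ ≤ 2 * (|t| / v ^ 12) ^ 3 * ((21 + 2 * C) * v ^ 24) := by
          rw [habs]; gcongr
      _ = 2 * (|t| ^ 3 * (21 + 2 * C)) / v ^ 12 := by field_simp
      _ ≤ 2 * (|t| ^ 3 * (21 + 2 * C)) / v := by gcongr; exact le_self_pow₀ hv1 (by norm_num)
  have hsum : (3 * |t| + 2 * (|t| * (20 + 2 * C)) + 5 * |t| + 2 * (|t| ^ 3 * (21 + 2 * C))) / v =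
      3 * |t| / v + (|t| * (20 + 2 * C) / v + |t| * (20 + 2 * C) / v +
        (5 * |t| / v + 2 * (|t| ^ 3 * (21 + 2 * C)) / v)) := by ring
  rw [hsum, deviationBound]
  linarith

theorem tendsto_pow_mul_div_two_pow (k : ℕ) (c : ℝ) :
    Tendsto (fun a : ℕ => (a : ℝ) ^ k * (c / 2 ^ a)) atTop (nhds 0) := by
  have := (tendsto_pow_const_div_const_pow_of_one_lt k (r := 2) (by norm_num)).const_mul c
  rw [mul_zero] at this
  exact this.congr fun a => by ring

theorem tendsto_sum_dyadicPrimes : Tendsto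
    (fun a : ℕ => ∑ p ∈ dyadicPrimes a (a ^ 2), 1 / (p : ℝ)) atTop atTop := by
  obtain ⟨C, -, hC⟩ := exists_abs_sum_prime_one_div_sub_loglog_le
  refine tendsto_atTop_mono' _ (f₁ := fun a : ℕ => Real.log a + -(2 * C + 1)) ?_ ?_
  · filter_upwards [eventually_ge_atTop 1] with a ha
    exact log_sub_le_sum_dyadicPrimes hC ha
  · exact tendsto_atTop_add_const_right _ _
      (Real.tendsto_log_atTop.comp tendsto_natCast_atTop_atTop)

theorem tendsto_deviationBound (C t : ℝ) : Tendsto (deviationBound C t) atTop (nhds 0) := by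
  have hS : Tendsto (fun a : ℕ => 4 / √(∑ p ∈ dyadicPrimes a (a ^ 2), 1 / (p : ℝ))) atTop
      (nhds 0) :=
    tendsto_const_nhds.div_atTop (Real.tendsto_sqrt_atTop.comp tendsto_sum_dyadicPrimes)
  have h2 : Tendsto (fun a : ℕ => (4 : ℝ) / 2 ^ a) atTop (nhds 0) := by
    simpa using tendsto_pow_mul_div_two_pow 0 4
  have h3 : Tendsto (fun a : ℕ => 2 * (2 ^ 24 + C) / (a : ℝ)) atTop (nhds 0) :=
    tendsto_const_nhds.div_atTop tendsto_natCast_atTop_atTop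
  set B := 8 + 4 * Real.exp (1 + 32 * (t ^ 2 * (21 + 2 * C))) with hB
  have h4 : Tendsto (fun a : ℕ => (a : ℝ) ^ 31 * (4 / 2 ^ a + 3 * (B / 2 ^ a +
      3 * t ^ 2 / a ^ 32))) atTop (nhds 0) := by
    have h5 : Tendsto (fun a : ℕ => 9 * t ^ 2 / (a : ℝ)) atTop (nhds 0) :=
      tendsto_const_nhds.div_atTop tendsto_natCast_atTop_atTop
    have h6 := (tendsto_pow_mul_div_two_pow 31 (4 + 3 * B)).add h5
    rw [add_zero] at h6
    refine h6.congr' ?_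
    filter_upwards [eventually_gt_atTop 0] with a ha
    have : (0 : ℝ) < a := by exact_mod_cast ha
    field_simp
    ring
  have h5 := (Real.continuous_sqrt.tendsto 0).comp h4
  rw [Real.sqrt_zero] at h5
  have := (hS.add h2).add (h3.add h5)
  simp only [add_zero] at this
  exact this

theorem eventually_floor_pow_lt : ∀ᶠ v : ℝ in atTop, ⌊v⌋₊ ^ 27 < 2 ^ ⌊v⌋₊ := by
  refine tendsto_nat_floor_atTop.eventually (p := fun a : ℕ => a ^ 27 < 2 ^ a) ?_
  have h := tendsto_pow_mul_div_two_pow 27 1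
  filter_upwards [h.eventually (gt_mem_nhds one_pos)] with a ha
  rw [mul_one_div, div_lt_one (by positivity)] at ha
  exact_mod_cast ha

theorem tendsto_log_log_rpow :
    Tendsto (fun x : ℝ => Real.log (Real.log x) ^ (1 / 24 : ℝ)) atTop atTop :=
  (tendsto_rpow_atTop (by norm_num)).comp (Real.tendsto_log_atTop.comp Real.tendsto_log_atTop)

/-- Convergence of the characteristic functions in the Erdős–Kac law for `ω (n + ω n)`. -/
theorem tendsto_avg_exp_add_omega (t : ℝ) :
    Tendsto (fun x : ℝ => (⌊x⌋₊ : ℂ)⁻¹ * ∑ n ∈ Finset.Icc 1 ⌊x⌋₊, Complex.exp (Complex.I *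
      ((t * (((n + n.primeFactors.card).primeFactors.card - Real.log (Real.log x)) /
        √(Real.log (Real.log x))) : ℝ) : ℂ))) atTop (nhds (Complex.exp ((-t ^ 2 / 2 : ℝ) : ℂ))) := by
  obtain ⟨C, hC0, hC⟩ := exists_abs_sum_prime_one_div_sub_loglog_le
  set v : ℝ → ℝ := fun x => Real.log (Real.log x) ^ (1 / 24 : ℝ) with hv
  have hvt : Tendsto v atTop atTop := tendsto_log_log_rpow
  have hat : Tendsto (fun x => ⌊v x⌋₊) atTop atTop := tendsto_nat_floor_atTop.comp hvt
  rw [tendsto_iff_norm_sub_tendsto_zero]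
  set c := 3 * |t| + 2 * (|t| * (20 + 2 * C)) + 5 * |t| + 2 * (|t| ^ 3 * (21 + 2 * C)) with hc
  have hlim : Tendsto (fun x => deviationBound C t ⌊v x⌋₊ + c / v x) atTop (nhds 0) := by
    have := ((tendsto_deviationBound C t).comp hat).add (tendsto_const_nhds.div_atTop hvt (a := c))
    rw [add_zero] at this
    exact this
  refine squeeze_zero' (Eventually.of_forall fun x => norm_nonneg _) ?_ hlim
  have htt : ∀ᶠ w : ℝ in atTop, |t / w ^ 12| ≤ 1 / 4 := by
    have h1 : Tendsto (fun w : ℝ => t / w ^ 12) atTop (nhds 0) :=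
      tendsto_const_nhds.div_atTop (tendsto_pow_atTop (by norm_num))
    have h2 := h1.abs
    rw [abs_zero] at h2
    filter_upwards [h2.eventually (gt_mem_nhds (by norm_num : (0 : ℝ) < 1 / 4))] with w hw
    exact hw.le
  filter_upwards [eventually_ge_atTop 2, hvt.eventually_ge_atTop 2,
    hvt.eventually eventually_floor_pow_lt, hvt.eventually htt,
    hat.eventually (tendsto_sum_dyadicPrimes.eventually_ge_atTop 1),
    (Real.tendsto_log_atTop.comp Real.tendsto_log_atTop).eventually_ge_atTop 0]
    with x hx h2 h3 h4 h5 h6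
  have hL : v x ^ 24 = Real.log (Real.log x) := by
    rw [hv]
    simp only
    rw [← Real.rpow_natCast, ← Real.rpow_mul (show 0 ≤ Real.log (Real.log x) from h6)]
    norm_num
  have hsq : √(Real.log (Real.log x)) = v x ^ 12 := by
    rw [← hL]
    rw [show v x ^ 24 = (v x ^ 12) ^ 2 by ring, Real.sqrt_sq (by positivity)]
  have hmain := norm_avg_phase_sub_exp_le_deviationBound hC0 hC hx h2 hL h3 h4 h5
  rw [hsq, ← hL]
  refine le_trans (le_of_eq ?_) hmain
  congr 4 with n
  congr 3
  ring

/-- The law of `g n` for `n` uniform on the finite set `s`. -/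
def empiricalMeasure (s : Finset ℕ) (g : ℕ → ℝ) : MeasureTheory.Measure ℝ :=
  (s.card : ENNReal)⁻¹ • ∑ n ∈ s, MeasureTheory.Measure.dirac (g n)

theorem empiricalMeasure_apply (s : Finset ℕ) (g : ℕ → ℝ) {A : Set ℝ} (hA : MeasurableSet A)
    [DecidablePred (· ∈ A)] :
    empiricalMeasure s g A = (s.card : ENNReal)⁻¹ * ((s.filter fun n => g n ∈ A).card : ENNReal) := by
  rw [empiricalMeasure, MeasureTheory.Measure.smul_apply, MeasureTheory.Measure.finsetSum_apply,
    smul_eq_mul]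
  congr 1
  rw [Finset.card_filter, Nat.cast_sum]
  refine Finset.sum_congr rfl fun n _ => ?_
  rw [MeasureTheory.Measure.dirac_apply' _ hA, Set.indicator_apply]
  simp

theorem isProbabilityMeasure_empiricalMeasure {s : Finset ℕ} (hs : s.Nonempty) (g : ℕ → ℝ) :
    MeasureTheory.IsProbabilityMeasure (empiricalMeasure s g) := by
  classical
  refine ⟨?_⟩
  rw [empiricalMeasure_apply s g MeasurableSet.univ]
  simp only [Set.mem_univ, Finset.filter_true]
  exact ENNReal.inv_mul_cancel (by simpa using hs.ne_empty) (ENNReal.natCast_ne_top _)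

theorem charFun_empiricalMeasure (s : Finset ℕ) (g : ℕ → ℝ) (t : ℝ) :
    MeasureTheory.charFun (empiricalMeasure s g) t =
      (s.card : ℂ)⁻¹ * ∑ n ∈ s, Complex.exp (Complex.I * ((t * g n : ℝ) : ℂ)) := by
  rw [MeasureTheory.charFun_apply_real, empiricalMeasure, MeasureTheory.integral_smul_measure,
    MeasureTheory.integral_finsetSum_measure]
  · simp only [MeasureTheory.integral_dirac, ENNReal.toReal_inv, ENNReal.toReal_natCast,
      Complex.real_smul, Complex.ofReal_inv, Complex.ofReal_natCast]
    congr 1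
    refine Finset.sum_congr rfl fun n _ => ?_
    congr 1
    push_cast
    ring
  · intro n _
    exact MeasureTheory.integrable_dirac (by simp)

theorem gaussianReal_real_Iic (u : ℝ) :
    (ProbabilityTheory.gaussianReal 0 1).real (Set.Iic u) =
      (√(2 * Real.pi))⁻¹ * ∫ t in Set.Iic u, Real.exp (-t ^ 2 / 2) := by
  rw [MeasureTheory.measureReal_def,
    ProbabilityTheory.gaussianReal_apply_eq_integral _ one_ne_zero, ENNReal.toReal_ofReal]
  · simp only [ProbabilityTheory.gaussianPDFReal, NNReal.coe_one, mul_one, sub_zero]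
    rw [MeasureTheory.integral_const_mul]
  · exact MeasureTheory.integral_nonneg fun _ => ProbabilityTheory.gaussianPDFReal_nonneg _ _ _

theorem tendsto_card_filter_div_of_tendsto_avg_exp {s : ℕ → Finset ℕ} (hs : ∀ k, (s k).Nonempty)
    {g : ℕ → ℕ → ℝ}
    (h : ∀ t : ℝ, Tendsto (fun k => ((s k).card : ℂ)⁻¹ *
      ∑ n ∈ s k, Complex.exp (Complex.I * ((t * g k n : ℝ) : ℂ))) atTop
      (nhds (Complex.exp ((-t ^ 2 / 2 : ℝ) : ℂ)))) (u : ℝ) :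
    Tendsto (fun k => (((s k).filter fun n => g k n ≤ u).card : ℝ) / (s k).card) atTop
      (nhds ((√(2 * Real.pi))⁻¹ * ∫ t in Set.Iic u, Real.exp (-t ^ 2 / 2))) := by
  let M : ℕ → MeasureTheory.ProbabilityMeasure ℝ := fun k =>
    ⟨empiricalMeasure (s k) (g k), isProbabilityMeasure_empiricalMeasure (hs k) _⟩
  let M₀ : MeasureTheory.ProbabilityMeasure ℝ := ⟨ProbabilityTheory.gaussianReal 0 1, inferInstance⟩
  have hM : Tendsto M atTop (nhds M₀) := by
    refine MeasureTheory.ProbabilityMeasure.tendsto_of_tendsto_charFun fun t => ?_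
    have h1 : MeasureTheory.charFun (M₀ : MeasureTheory.Measure ℝ) t =
        Complex.exp ((-t ^ 2 / 2 : ℝ) : ℂ) := by
      change MeasureTheory.charFun (ProbabilityTheory.gaussianReal 0 1) t = _
      rw [ProbabilityTheory.charFun_gaussianReal]
      congr 1
      push_cast
      simp
      ring
    rw [h1]
    exact (h t).congr fun k => (charFun_empiricalMeasure (s k) (g k) t).symm
  have hfr : (M₀ : MeasureTheory.Measure ℝ) (frontier (Set.Iic u)) = 0 := by
    have : MeasureTheory.NullSingletonClass (M₀ : MeasureTheory.Measure ℝ) :=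
      ProbabilityTheory.nullSingletonClass_gaussianReal one_ne_zero
    rw [frontier_Iic]
    exact MeasureTheory.measure_singleton u
  have h2 := MeasureTheory.ProbabilityMeasure.tendsto_measure_of_null_frontier_of_tendsto' hM hfr
  have h3 := (ENNReal.tendsto_toReal (MeasureTheory.measure_ne_top _ _)).comp h2
  have h4 : ((M₀ : MeasureTheory.Measure ℝ) (Set.Iic u)).toReal = _ := gaussianReal_real_Iic u
  rw [h4] at h3
  refine h3.congr fun k => ?_
  change (empiricalMeasure (s k) (g k) (Set.Iic u)).toReal = _
  classical
  rw [empiricalMeasure_apply _ _ measurableSet_Iic]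
  simp [div_eq_inv_mul]

end

/-- Erdős–Kac law for ω(n + ω(n)). -/
theorem erdosKac_add_omega (u : ℝ) :
    Tendsto (fun x : ℝ =>
      (((Finset.Icc 2 ⌊x⌋₊).filter (fun n : ℕ =>
        ((((n + n.primeFactors.card).primeFactors.card : ℝ) : ℝ)) - Real.log (Real.log x)
          ≤ u * Real.sqrt (Real.log (Real.log x)))).card : ℝ) / x)
      atTop
      (nhds ((Real.sqrt (2 * Real.pi))⁻¹ * ∫ t in Set.Iic u, Real.exp (-t ^ 2 / 2))) := by
  set I := (√(2 * Real.pi))⁻¹ * ∫ t in Set.Iic u, Real.exp (-t ^ 2 / 2) with hI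
  set p : ℝ → ℕ → Prop := fun x n =>
    ((n + n.primeFactors.card).primeFactors.card : ℝ) - Real.log (Real.log x) ≤
      u * √(Real.log (Real.log x)) with hp
  have hfull : Tendsto (fun x : ℝ => (((Finset.Icc 1 ⌊x⌋₊).filter (p x)).card : ℝ) / ⌊x⌋₊) atTop
      (nhds I) := by
    refine tendsto_of_seq_tendsto fun x hx => ?_
    have hL := (Real.tendsto_log_atTop.comp Real.tendsto_log_atTop).comp hx
    have key := tendsto_card_filter_div_of_tendsto_avg_exp
      (s := fun k => Finset.Icc 1 (max 1 ⌊x k⌋₊))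
      (g := fun k n => (((n + n.primeFactors.card).primeFactors.card : ℝ) -
        Real.log (Real.log (x k))) / √(Real.log (Real.log (x k))))
      (fun k => ⟨1, by simp⟩) (fun t => ?_) u
    · refine key.congr' ?_
      filter_upwards [hx.eventually_ge_atTop 1, hL.eventually_gt_atTop 0] with k h1 h2
      have h3 : max 1 ⌊x k⌋₊ = ⌊x k⌋₊ := max_eq_right (Nat.le_floor (by simpa using h1))
      have h4 : 0 < √(Real.log (Real.log (x k))) := Real.sqrt_pos.2 h2
      simp only [h3, Nat.card_Icc, Nat.add_sub_cancel, hp, div_le_iff₀ h4, Function.comp_apply]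
    · refine ((tendsto_avg_exp_add_omega t).comp hx).congr' ?_
      filter_upwards [hx.eventually_ge_atTop 1] with k h1
      have h3 : max 1 ⌊x k⌋₊ = ⌊x k⌋₊ := max_eq_right (Nat.le_floor (by simpa using h1))
      simp only [h3, Nat.card_Icc, Nat.add_sub_cancel, Function.comp_apply]
  have hprod := hfull.mul (tendsto_nat_floor_div_atTop (R := ℝ))
  rw [mul_one] at hprod
  refine tendsto_of_tendsto_of_dist hprod ?_
  refine squeeze_zero' (Eventually.of_forall fun x => dist_nonneg) ?_ tendsto_inv_atTop_zero
  filter_upwards [eventually_ge_atTop 1] with x hx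
  have hx0 : 0 < x := by linarith
  have hN : 1 ≤ ⌊x⌋₊ := Nat.le_floor (by simpa using hx)
  have hN0 : (0 : ℝ) < ⌊x⌋₊ := by exact_mod_cast hN
  have hins : Finset.Icc 1 ⌊x⌋₊ = insert 1 (Finset.Icc 2 ⌊x⌋₊) :=
    (Finset.insert_Icc_succ_left_eq_Icc hN).symm
  have h1 : ((Finset.Icc 2 ⌊x⌋₊).filter (p x)).card ≤ ((Finset.Icc 1 ⌊x⌋₊).filter (p x)).card :=
    Finset.card_le_card (Finset.filter_subset_filter _ (hins ▸ Finset.subset_insert _ _))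
  have h2 : ((Finset.Icc 1 ⌊x⌋₊).filter (p x)).card ≤
      ((Finset.Icc 2 ⌊x⌋₊).filter (p x)).card + 1 := by
    rw [hins, Finset.filter_insert]
    split_ifs
    · exact Finset.card_insert_le _ _
    · omega
  have h1' : (((Finset.Icc 2 ⌊x⌋₊).filter (p x)).card : ℝ) ≤
    ((Finset.Icc 1 ⌊x⌋₊).filter (p x)).card := by exact_mod_cast h1
  have h2' : (((Finset.Icc 1 ⌊x⌋₊).filter (p x)).card : ℝ) ≤
    ((Finset.Icc 2 ⌊x⌋₊).filter (p x)).card + 1 := by exact_mod_cast h2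
  rw [div_mul_div_cancel₀ hN0.ne', Real.dist_eq, ← sub_div, abs_div, abs_of_pos hx0,
    div_le_iff₀ hx0, inv_mul_cancel₀ hx0.ne', abs_of_nonneg (by linarith)]
  linarith
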